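/- arXiv:1003.5983 — 3 statements merged into one kernel-verified Lean document; each statement's English description precedes it below -/
import Mathlib

section
/- There exists an analytic set U ⊆ 2^ℕ × [ω]^ω which is universal for analytic subsets of [ω]^ω (i.e., U is analytic and every analytic set A ⊆ [ω]^ω equals a section U_x = {a ∈ [ω]^ω : (x,a) ∈ U} for some x ∈ 2^ℕ) such that the set {x ∈ 2^ℕ : U_x is Ramsey positive} is Σ¹₂-complete. -/
open MeasureTheory TopologicalSpace

/-- The space `[ω]^ω` of infinite subsets of `ℕ`, topologized as a subspace of the
Cantor space `ℕ → Bool` via characteristic functions. -/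
abbrev IOI := {x : ℕ → Bool // {n | x n = true}.Infinite}

/-- A set is `Σ¹₂` if it is the image of a coanalytic subset of Baire space under a
continuous map. -/
def Sigma12 {X : Type*} [TopologicalSpace X] (A : Set X) : Prop :=
  ∃ (C : Set (ℕ → ℕ)) (f : (ℕ → ℕ) → X),
    MeasureTheory.AnalyticSet Cᶜ ∧ Continuous f ∧ f '' C = A

/-- A topological space is zero-dimensional if it has a basis of clopen sets. -/
def ZeroDim (X : Type*) [TopologicalSpace X] : Prop :=
  ∃ b : Set (Set X), (∀ s ∈ b, IsClopen s) ∧ TopologicalSpace.IsTopologicalBasis b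

/-- `A` is `Σ¹₂`-complete: `A` is `Σ¹₂` and every `Σ¹₂` subset of a zero-dimensional
Polish space is a continuous preimage of `A`. -/
def Sigma12Complete {X : Type*} [TopologicalSpace X] (A : Set X) : Prop :=
  Sigma12 A ∧
  ∀ (Z : Type) [TopologicalSpace Z] [PolishSpace Z], ZeroDim Z →
    ∀ B : Set Z, Sigma12 B → ∃ f : Z → X, Continuous f ∧ f ⁻¹' A = B

/-- The Ellentuck basic set `[σ,s]`: all infinite `a ⊆ ℕ` with `a ∩ {0,…,max σ} = σ`
and every element of `a` greater than `max σ` lying in `s` (stated max-free: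
`σ ⊆ a`, and every element of `a` outside `σ` lies in `s` and is above all of `σ`). -/
def ES (σ : Finset ℕ) (s : Set ℕ) : Set IOI :=
  {a | (∀ m ∈ σ, a.1 m = true) ∧
       ∀ n, a.1 n = true → n ∉ σ → n ∈ s ∧ ∀ m ∈ σ, m < n}

/-- A legitimate Ellentuck pair: `s` is infinite and `max σ < min s`. -/
def GoodPair (σ : Finset ℕ) (s : Set ℕ) : Prop :=
  s.Infinite ∧ ∀ m ∈ σ, ∀ n ∈ s, m < n

/-- `A ⊆ [ω]^ω` is Ramsey null if every Ellentuck basic set `[σ,s]` can be shrunk to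
`[σ,s']` (with `s' ⊆ s` infinite, `min s' > max σ`) disjoint from `A`. -/
def RamseyNull (A : Set IOI) : Prop :=
  ∀ σ : Finset ℕ, ∀ s : Set ℕ, GoodPair σ s →
    ∃ s' ⊆ s, s'.Infinite ∧ (∀ m ∈ σ, ∀ n ∈ s', m < n) ∧ ES σ s' ∩ A = ∅

/-- `A` is Ramsey positive if it is not Ramsey null. -/
def RamseyPositive (A : Set IOI) : Prop := ¬ RamseyNull A


/-! ### Ellentuck sets and largeness -/

/-- The initial segment `a ∩ {0, …, n - 1}`. -/
def seg (a : IOI) (n : ℕ) : Finset ℕ := (Finset.range n).filter (fun m => a.1 m = true)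

theorem mem_seg {a : IOI} {n m : ℕ} : m ∈ seg a n ↔ m < n ∧ a.1 m = true := by
  simp [seg]

/-- The part of `s` lying strictly above the finite set `t`. -/
def above (t : Finset ℕ) (s : Set ℕ) : Set ℕ := {n ∈ s | ∀ m ∈ t, m < n}

theorem above_subset (t : Finset ℕ) (s : Set ℕ) : above t s ⊆ s := fun _ h => h.1

theorem above_infinite (t : Finset ℕ) {s : Set ℕ} (hs : s.Infinite) : (above t s).Infinite := by
  refine (hs.sdiff (Finset.range (t.sup id + 1)).finite_toSet).mono ?_
  rintro n ⟨hn, hn'⟩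
  refine ⟨hn, fun m hm => ?_⟩
  have : m ≤ t.sup id := Finset.le_sup (f := id) hm
  simp at hn'
  omega

theorem ES_above (t : Finset ℕ) (s : Set ℕ) : ES t (above t s) = ES t s := by
  ext a
  constructor
  · rintro ⟨h1, h2⟩
    exact ⟨h1, fun n hn hnt => ⟨(h2 n hn hnt).1.1, (h2 n hn hnt).2⟩⟩
  · rintro ⟨h1, h2⟩
    exact ⟨h1, fun n hn hnt => ⟨h2 n hn hnt, (h2 n hn hnt).2⟩⟩

theorem ES_mono (t : Finset ℕ) {s s' : Set ℕ} (h : s' ⊆ s) : ES t s' ⊆ ES t s :=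
  fun _ ha => ⟨ha.1, fun n hn hnt => ⟨h (ha.2 n hn hnt).1, (ha.2 n hn hnt).2⟩⟩

theorem mem_ES_seg {t : Finset ℕ} {s : Set ℕ} {a : IOI} (ha : a ∈ ES t s) {n : ℕ}
    (h : t ⊆ seg a n) : a ∈ ES (seg a n) s := by
  refine ⟨fun m hm => (mem_seg.1 hm).2, fun m hm hmn => ?_⟩
  have hnm : n ≤ m := by
    by_contra hlt
    exact hmn (mem_seg.2 ⟨by omega, hm⟩)
  exact ⟨(ha.2 m hm fun h' => hmn (h h')).1, fun k hk => (mem_seg.1 hk).1.trans_le hnm⟩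

theorem subset_seg_succ {t : Finset ℕ} {s : Set ℕ} {a : IOI} (ha : a ∈ ES t s) {k : ℕ}
    (hk : a.1 k = true) (hkt : k ∉ t) : t ⊆ seg a (k + 1) := fun m hm =>
  mem_seg.2 ⟨by have := (ha.2 k hk hkt).2 m hm; omega, ha.1 m hm⟩

theorem exists_mem_gt (a : IOI) (t : Finset ℕ) (N : ℕ) : ∃ k, a.1 k = true ∧ k ∉ t ∧ N ≤ k := by
  obtain ⟨k, hk, hk'⟩ := (a.2.sdiff (t ∪ Finset.range N).finite_toSet).nonempty
  simp at hk'
  exact ⟨k, hk, hk'.1, hk'.2⟩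

theorem seg_congr {a b : IOI} {s : Set ℕ} {k : ℕ} (hk : a.1 k = true)
    (hb : b ∈ ES (seg a (k + 1)) s) : ∀ m ≤ k, b.1 m = a.1 m := by
  intro m hm
  have hkk : k ∈ seg a (k + 1) := mem_seg.2 ⟨by omega, hk⟩
  cases ham : a.1 m
  · by_contra hbm
    have hmn : m ∉ seg a (k + 1) := fun h => by simp [(mem_seg.1 h).2] at ham
    have := (hb.2 m (by simpa using hbm) hmn).2 k hkk
    omega
  · exact hb.1 m (mem_seg.2 ⟨by omega, ham⟩)

theorem seg_eq_of_mem {a b : IOI} {s : Set ℕ} {k : ℕ} (hk : a.1 k = true)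
    (hb : b ∈ ES (seg a (k + 1)) s) : seg b (k + 1) = seg a (k + 1) := by
  ext m
  rw [mem_seg, mem_seg]
  exact and_congr_right fun h => by rw [seg_congr hk hb m (by omega)]

/-- Either an initial segment of a member of `[t,s]` equals `t`, or it ends in `s`. -/
theorem seg_eq_or_sup_mem {t : Finset ℕ} {s : Set ℕ} {a : IOI} (ha : a ∈ ES t s) {m : ℕ}
    (h : t ⊆ seg a m) :
    seg a m = t ∨ ((seg a m).Nonempty ∧ (seg a m).sup id ∈ s) := by
  by_cases heq : seg a m = t
  · exact Or.inl heq
  right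
  obtain ⟨k, hk, hkt⟩ : ∃ k ∈ seg a m, k ∉ t := by
    by_contra! hcon
    exact heq (Finset.Subset.antisymm hcon h)
  have hne : (seg a m).Nonempty := ⟨k, hk⟩
  refine ⟨hne, ?_⟩
  obtain ⟨j, hj, hj'⟩ := Finset.exists_mem_eq_sup (seg a m) hne id
  rw [hj']
  have hkj : k ≤ j := by
    have := Finset.le_sup (f := id) hk
    rw [hj'] at this
    exact this
  have hjt : j ∉ t := fun hjt => by
    have := (ha.2 k (mem_seg.1 hk).2 hkt).2 j hjt
    omega
  exact (ha.2 j (mem_seg.1 hj).2 hjt).1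

theorem sup_seg_succ {a : IOI} {k : ℕ} (hk : a.1 k = true) : (seg a (k + 1)).sup id = k := by
  apply le_antisymm
  · refine Finset.sup_le fun m hm => ?_
    have := (mem_seg.1 hm).1
    simp only [id]
    omega
  · exact Finset.le_sup (f := id) (mem_seg.2 ⟨by omega, hk⟩)

/-- `B` meets `[t,s']` for every infinite `s' ⊆ s`. -/
def Large (B : Set IOI) (t : Finset ℕ) (s : Set ℕ) : Prop :=
  ∀ s' ⊆ s, s'.Infinite → (ES t s' ∩ B).Nonempty

theorem Large.mono {B : Set IOI} {t : Finset ℕ} {s s' : Set ℕ} (h : Large B t s) (hs : s' ⊆ s) :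
    Large B t s' := fun u hu hi => h u (hu.trans hs) hi

theorem Large.of_above {B : Set IOI} {t u : Finset ℕ} {s : Set ℕ}
    (h : Large B u (above t s)) : Large B u s := by
  intro s' hs' hi
  obtain ⟨a, ha, hb⟩ := h (above t s') (fun n hn => ⟨hs' hn.1, hn.2⟩) (above_infinite t hi)
  exact ⟨a, ES_mono u (above_subset t s') ha, hb⟩

theorem exists_disjoint_of_not_large {B : Set IOI} {t : Finset ℕ} {s : Set ℕ}
    (h : ¬ Large B t s) : ∃ s' ⊆ s, s'.Infinite ∧ ES t s' ∩ B = ∅ := by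
  simp only [Large, not_forall, Set.not_nonempty_iff_eq_empty] at h
  obtain ⟨s', h1, h2, h3⟩ := h
  exact ⟨s', h1, h2, h3⟩

theorem ramseyPositive_iff {A : Set IOI} :
    RamseyPositive A ↔ ∃ (σ : Finset ℕ) (s : Set ℕ), s.Infinite ∧ Large A σ s := by
  constructor
  · intro h
    simp only [RamseyPositive, RamseyNull, not_forall, not_exists, not_and] at h
    obtain ⟨σ, s, hg, h⟩ := h
    refine ⟨σ, s, hg.1, fun s' hs' hi => Set.nonempty_iff_ne_empty.2 ?_⟩
    exact h s' hs' hi fun m hm n hn => hg.2 m hm n (hs' hn)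
  · rintro ⟨σ, s, hi, hL⟩ hnull
    obtain ⟨s', hs', hi', -, he⟩ :=
      hnull σ (above σ s) ⟨above_infinite σ hi, fun m hm n hn => hn.2 m hm⟩
    obtain ⟨a, ha⟩ := hL s' (hs'.trans (above_subset σ s)) hi'
    rw [he] at ha
    exact ha

/-! ### Fusion -/

theorem exists_subset_forall_finset {ι : Type*} (P : ι → Set ℕ → Prop)
    (mono : ∀ i s s', s' ⊆ s → P i s → P i s')
    (dense : ∀ i s, s.Infinite → ∃ s' ⊆ s, s'.Infinite ∧ P i s') (F : Finset ι) (s : Set ℕ)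
    (hs : s.Infinite) : ∃ s' ⊆ s, s'.Infinite ∧ ∀ i ∈ F, P i s' := by
  classical
  induction F using Finset.induction with
  | empty => exact ⟨s, subset_rfl, hs, by simp⟩
  | insert i F _ ih =>
    obtain ⟨s1, h1, hi1, hP1⟩ := ih
    obtain ⟨s2, h2, hi2, hP2⟩ := dense i s1 hi1
    refine ⟨s2, h2.trans h1, hi2, fun j hj => ?_⟩
    rcases Finset.mem_insert.1 hj with rfl | hj
    · exact hP2
    · exact mono _ _ _ h2 (hP1 j hj)

theorem exists_diagonal (Q : ℕ → Set ℕ → Prop) (mono : ∀ k s s', s' ⊆ s → Q k s → Q k s')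
    (dense : ∀ k s, s.Infinite → ∃ s' ⊆ s, s'.Infinite ∧ Q k s') (s : Set ℕ) (hs : s.Infinite) :
    ∃ s' ⊆ s, s'.Infinite ∧ ∀ k ∈ s', Q k (s' ∩ Set.Ioi k) := by
  have step : ∀ S : {S : Set ℕ // S.Infinite}, ∃ p : ℕ × {S : Set ℕ // S.Infinite},
      p.1 ∈ S.1 ∧ p.2.1 ⊆ S.1 ∩ Set.Ioi p.1 ∧ Q p.1 p.2.1 := by
    rintro ⟨S, hS⟩
    obtain ⟨k, hk⟩ := hS.nonempty
    have : (S ∩ Set.Ioi k).Infinite := by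
      refine (hS.sdiff (Set.finite_Iic k)).mono ?_
      rintro n ⟨h1, h2⟩
      exact ⟨h1, by simpa using h2⟩
    obtain ⟨S', h1, h2, h3⟩ := dense k _ this
    exact ⟨(k, ⟨S', h2⟩), hk, h1, h3⟩
  choose p hp1 hp2 hp3 using step
  let T : ℕ → {S : Set ℕ // S.Infinite} := fun n => Nat.rec ⟨s, hs⟩ (fun _ S => (p S).2) n
  have hT : ∀ n, (T (n + 1)).1 ⊆ (T n).1 ∩ Set.Ioi (p (T n)).1 := fun n => hp2 (T n)
  have hanti : Antitone fun n => (T n).1 :=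
    antitone_nat_of_succ_le fun n => (hT n).trans Set.inter_subset_left
  let κ : ℕ → ℕ := fun n => (p (T n)).1
  have hκ : StrictMono κ := strictMono_nat_of_lt_succ fun n => (hT n (hp1 (T (n + 1)))).2
  refine ⟨Set.range κ, ?_, Set.infinite_range_of_injective hκ.injective, ?_⟩
  · rintro _ ⟨n, rfl⟩
    exact hanti (Nat.zero_le n) (hp1 (T n))
  · rintro _ ⟨n, rfl⟩
    refine mono _ _ _ ?_ (hp3 (T n))
    rintro _ ⟨⟨m, rfl⟩, hm⟩
    have : n + 1 ≤ m := hκ.lt_iff_lt.1 hm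
    exact hanti this (hp1 (T m))

theorem exists_fusion (P : ℕ → Finset ℕ → Set ℕ → Prop)
    (mono : ∀ i t s s', s' ⊆ s → P i t s → P i t s')
    (dense : ∀ i t s, s.Infinite → ∃ s' ⊆ s, s'.Infinite ∧ P i t s')
    (tail : ∀ i t s, P i t (above t s) → P i t s) (σ : Finset ℕ) (s : Set ℕ) (hs : s.Infinite) :
    ∃ s' ⊆ s, s'.Infinite ∧
      ∀ t : Finset ℕ, (t = σ ∨ (t.Nonempty ∧ t.sup id ∈ s')) → ∀ i ≤ t.sup id, P i t s' := by
  obtain ⟨s1, h1, hi1, hP1⟩ := exists_subset_forall_finset (fun i => P i σ) (fun i => mono i σ)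
    (fun i => dense i σ) (Finset.range (σ.sup id + 1)) s hs
  obtain ⟨s2, h2, hi2, hP2⟩ := exists_diagonal
    (fun k s => ∀ q ∈ Finset.range (k + 1) ×ˢ (Finset.range (k + 1)).powerset, P q.1 q.2 s)
    (fun k s s' hss h q hq => mono _ _ _ _ hss (h q hq))
    (fun k s hs => exists_subset_forall_finset (fun q : ℕ × Finset ℕ => P q.1 q.2)
      (fun q => mono q.1 q.2) (fun q => dense q.1 q.2) _ s hs) s1 hi1
  refine ⟨s2, h2.trans h1, hi2, ?_⟩
  rintro t (rfl | ⟨hne, ht⟩) i hi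
  · exact mono _ _ _ _ h2 (hP1 i (by simp; omega))
  · apply tail
    refine mono _ _ _ _ ?_ (hP2 _ ht (i, t) ?_)
    · rintro n ⟨hn, hn'⟩
      obtain ⟨j, hj, hj'⟩ := Finset.exists_mem_eq_sup t hne id
      exact ⟨hn, by rw [hj']; exact hn' j hj⟩
    · simp only [Finset.mem_product, Finset.mem_range, Finset.mem_powerset]
      refine ⟨by omega, fun m hm => ?_⟩
      have : m ≤ t.sup id := Finset.le_sup (f := id) hm
      simp
      omega

theorem exists_decided (B : ℕ → Set IOI) (σ : Finset ℕ) (s : Set ℕ) (hs : s.Infinite) :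
    ∃ s' ⊆ s, s'.Infinite ∧
      ∀ t : Finset ℕ, (t = σ ∨ (t.Nonempty ∧ t.sup id ∈ s')) → ∀ i ≤ t.sup id,
        Large (B i) t s' ∨ ES t s' ∩ B i = ∅ := by
  refine exists_fusion (fun i t s => Large (B i) t s ∨ ES t s ∩ B i = ∅) ?_ ?_ ?_ σ s hs
  · rintro i t s s' hss (h | h)
    · exact Or.inl (h.mono hss)
    · exact Or.inr (Set.subset_eq_empty (Set.inter_subset_inter_left _ (ES_mono t hss)) h)
  · intro i t s hs
    by_cases h : Large (B i) t s
    · exact ⟨s, subset_rfl, hs, Or.inl h⟩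
    · obtain ⟨s', h1, h2, h3⟩ := exists_disjoint_of_not_large h
      exact ⟨s', h1, h2, Or.inr h3⟩
  · rintro i t s (h | h)
    · exact Or.inl (h.of_above)
    · rw [ES_above] at h
      exact Or.inr h

/-- Open sets are Ramsey: the set of all `a ∈ [t,s]` having a proper end-extension of `t` in `𝓕`
as an initial segment either contains or misses some `[t,s']`. -/
theorem exists_homogeneous (𝓕 : Set (Finset ℕ)) (t : Finset ℕ) (s : Set ℕ) (hs : s.Infinite) :
    ∃ s' ⊆ s, s'.Infinite ∧
      ((∀ a ∈ ES t s', ∃ k, a.1 k = true ∧ k ∉ t ∧ seg a (k + 1) ∈ 𝓕) ∨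
        ∀ a ∈ ES t s', ∀ k, a.1 k = true → k ∉ t → seg a (k + 1) ∉ 𝓕) := by
  let N : Set IOI := {a | ∀ k, a.1 k = true → k ∉ t → seg a (k + 1) ∉ 𝓕}
  by_cases hL : Large N t s
  swap
  · obtain ⟨s', h1, h2, h3⟩ := exists_disjoint_of_not_large hL
    refine ⟨s', h1, h2, Or.inl fun a ha => ?_⟩
    by_contra! hcon
    exact Set.eq_empty_iff_forall_notMem.1 h3 a ⟨ha, hcon⟩
  obtain ⟨s1, h1, hi1, hD⟩ := exists_decided (fun _ => N) t s hs
  have hfin : ∀ u, Large N u s1 → {n ∈ above u s1 | ¬ Large N (insert n u) s1}.Finite := by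
    intro u hu
    by_contra hinf
    obtain ⟨b, hb, hbN⟩ := hu _ (fun n hn => hn.1.1) hinf
    have hex : ∃ n, b.1 n = true ∧ n ∉ u := by
      obtain ⟨k, hk, hk', -⟩ := exists_mem_gt b u 0
      exact ⟨k, hk, hk'⟩
    classical
    obtain ⟨hn1, hn2⟩ := Nat.find_spec hex
    set n := Nat.find hex with hn
    obtain ⟨⟨⟨hns, -⟩, hnL⟩, hnu⟩ := hb.2 n hn1 hn2
    have hseg : seg b (n + 1) = insert n u := by
      ext m
      rw [mem_seg, Finset.mem_insert]
      constructor
      · rintro ⟨hm, hbm⟩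
        by_cases hmu : m ∈ u
        · exact Or.inr hmu
        · have := Nat.find_min' hex ⟨hbm, hmu⟩
          omega
      · rintro (rfl | hm)
        · exact ⟨by omega, hn1⟩
        · exact ⟨by have := hnu m hm; omega, hb.1 m hm⟩
    have hsup : (insert n u).sup id = n := by rw [← hseg]; exact sup_seg_succ hn1
    rcases hD (insert n u) (Or.inr ⟨by simp, by rw [hsup]; exact hns⟩) 0 (by omega) with h | h
    · exact hnL h
    · refine Set.eq_empty_iff_forall_notMem.1 h b ⟨?_, hbN⟩
      rw [← hseg]
      exact mem_ES_seg (ES_mono u (fun n hn => hn.1.1) hb) (by rw [hseg]; simp)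
  obtain ⟨s2, h2, hi2, hP⟩ := exists_fusion
    (fun _ u S => Large N u s1 → ∀ n ∈ above u S, n ∈ s1 → Large N (insert n u) s1)
    (fun _ u S S' hSS h hu n hn hn1 => h hu n ⟨hSS hn.1, hn.2⟩ hn1)
    (fun _ u S hS => by
      by_cases hu : Large N u s1
      · refine ⟨S \ {n ∈ above u s1 | ¬ Large N (insert n u) s1}, Set.sdiff_subset,
          hS.sdiff (hfin u hu), fun _ n hn hn1 => ?_⟩
        by_contra hcon
        exact hn.1.2 ⟨⟨hn1, hn.2⟩, hcon⟩
      · exact ⟨S, subset_rfl, hS, fun h => absurd h hu⟩)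
    (fun _ u S h hu n hn => h hu n ⟨hn, hn.2⟩) t s1 hi1
  refine ⟨s2, h2.trans h1, hi2, Or.inr fun a ha => ?_⟩
  have key : ∀ m, t ⊆ seg a m → Large N (seg a m) s1 := by
    intro m
    induction m with
    | zero =>
      intro h
      have : t = seg a 0 := Finset.Subset.antisymm h (by simp [seg])
      rw [← this]
      exact hL.mono h1
    | succ m ih =>
      intro h
      cases ham : a.1 m
      · have : seg a (m + 1) = seg a m := by
          ext j
          rw [mem_seg, mem_seg]
          constructor
          · rintro ⟨hj, haj⟩
            refine ⟨?_, haj⟩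
            rcases Nat.lt_succ_iff_lt_or_eq.1 hj with hj | rfl
            · exact hj
            · simp [haj] at ham
          · rintro ⟨hj, haj⟩
            exact ⟨by omega, haj⟩
        rw [this] at h ⊢
        exact ih h
      have hins : seg a (m + 1) = insert m (seg a m) := by
        ext j
        rw [Finset.mem_insert, mem_seg, mem_seg]
        constructor
        · rintro ⟨hj, haj⟩
          rcases Nat.lt_succ_iff_lt_or_eq.1 hj with hj | rfl
          · exact Or.inr ⟨hj, haj⟩
          · exact Or.inl rfl
        · rintro (rfl | ⟨hj, haj⟩)
          · exact ⟨by omega, ham⟩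
          · exact ⟨by omega, haj⟩
      by_cases hmt : m ∈ t
      · have : seg a (m + 1) = t := by
          refine Finset.Subset.antisymm (fun j hj => ?_) h
          by_contra hjt
          have h1 := (ha.2 j (mem_seg.1 hj).2 hjt).2 m hmt
          have h2 := (mem_seg.1 hj).1
          omega
        rw [this]
        exact hL.mono h1
      · have hts : t ⊆ seg a m := fun j hj => by
          rcases Finset.mem_insert.1 (hins ▸ h hj) with rfl | h'
          · exact absurd hj hmt
          · exact h'
        have hms := (ha.2 m ham hmt).1
        rw [hins]
        exact hP (seg a m) (seg_eq_or_sup_mem ha hts) 0 (Nat.zero_le _) (ih hts) m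
          ⟨hms, fun j hj => (mem_seg.1 hj).1⟩ (h2 hms)
  intro k hk hkt hF
  obtain ⟨b, hb, hbN⟩ := key (k + 1) (subset_seg_succ ha hk hkt) s1 subset_rfl hi1
  have hbk : b.1 k = true := by rw [seg_congr hk hb k le_rfl, hk]
  exact hbN k hbk hkt (by rw [seg_eq_of_mem hk hb]; exact hF)

/-- If a union of countably many sets is large at `t`, then below a suitable `s'` each member of
`[t,s']` passes through a stem at which one of the sets is large. -/
theorem exists_large_iUnion (B : ℕ → Set IOI) (A : Set IOI) (hA : A ⊆ ⋃ n, B n) (c : ℕ → ℕ)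
    (t : Finset ℕ) (s : Set ℕ) (hs : s.Infinite) (hL : Large A t s) :
    ∃ s' ⊆ s, s'.Infinite ∧ ∀ a ∈ ES t s', ∃ k n, a.1 k = true ∧ k ∉ t ∧ c n ≤ k ∧
      Large (B n) (seg a (k + 1)) s' := by
  obtain ⟨s1, h1, hi1, hD⟩ := exists_decided B t s hs
  obtain ⟨s2, h2, hi2, h⟩ := exists_homogeneous {u | ∃ n, c n ≤ u.sup id ∧ Large (B n) u s1} t s1 hi1
  refine ⟨s2, h2.trans h1, hi2, ?_⟩
  rcases h with h | h
  · intro a ha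
    obtain ⟨k, hk, hkt, n, hn, hLn⟩ := h a ha
    rw [sup_seg_succ hk] at hn
    exact ⟨k, n, hk, hkt, hn, hLn.mono h2⟩
  · obtain ⟨a, ha, haA⟩ := hL s2 (h2.trans h1) hi2
    obtain ⟨n, hn⟩ := Set.mem_iUnion.1 (hA haA)
    obtain ⟨k, hk, hkt, hkn⟩ := exists_mem_gt a t (max n (c n))
    have hsub := subset_seg_succ ha hk hkt
    exfalso
    rcases hD (seg a (k + 1)) (seg_eq_or_sup_mem (ES_mono t h2 ha) hsub) n
      (by rw [sup_seg_succ hk]; exact (le_max_left _ _).trans hkn) with h' | h'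
    · exact h a ha k hk hkt ⟨n, by rw [sup_seg_succ hk]; exact (le_max_right _ _).trans hkn, h'⟩
    · exact Set.eq_empty_iff_forall_notMem.1 h' a ⟨mem_ES_seg (ES_mono t h2 ha) hsub, hn⟩

/-- An index bound for finite sequences. -/
def listIdx (τ : List ℕ) : ℕ := max (Encodable.encode τ) τ.length

/-- The stem `t` is long enough to take `τ` into account, and `B τ` is large there. -/
def Certified (B : List ℕ → Set IOI) (s : Set ℕ) (σ : Finset ℕ) (τ : List ℕ) (t : Finset ℕ) :
    Prop :=
  σ ⊆ t ∧ listIdx τ ≤ t.sup id ∧ Large (B τ) t s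

theorem exists_certified (B : List ℕ → Set IOI) (hB : ∀ τ, B τ ⊆ ⋃ n, B (n :: τ)) (σ : Finset ℕ)
    (s : Set ℕ) (hs : s.Infinite) (hL : Large (B []) σ s) :
    ∃ s' ⊆ s, s'.Infinite ∧ ∀ a ∈ ES σ s', (∃ m, Certified B s' σ [] (seg a m)) ∧
      ∀ m τ, Certified B s' σ τ (seg a m) → ∃ n m', Certified B s' σ (n :: τ) (seg a m') := by
  obtain ⟨s1, h1, hi1, h⟩ := exists_large_iUnion (fun _ => B []) (B [])
    (fun a ha => Set.mem_iUnion.2 ⟨0, ha⟩) (fun _ => listIdx []) σ s hs hL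
  obtain ⟨s2, h2, hi2, hP⟩ := exists_fusion
    (fun i t S => ∀ τ : List ℕ, Encodable.encode τ = i → ES t S ∩ B τ = ∅ ∨
      ∀ a ∈ ES t S, ∃ k n, a.1 k = true ∧ k ∉ t ∧ listIdx (n :: τ) ≤ k ∧
        Large (B (n :: τ)) (seg a (k + 1)) S)
    (fun i t S S' hSS h τ hτ => by
      rcases h τ hτ with h | h
      · exact Or.inl (Set.subset_eq_empty (Set.inter_subset_inter_left _ (ES_mono t hSS)) h)
      · refine Or.inr fun a ha => ?_
        obtain ⟨k, n, e1, e2, e3, e4⟩ := h a (ES_mono t hSS ha)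
        exact ⟨k, n, e1, e2, e3, e4.mono hSS⟩)
    (fun i t S hS => by
      by_cases hi : ∃ τ : List ℕ, Encodable.encode τ = i
      · obtain ⟨τ, rfl⟩ := hi
        by_cases hLτ : Large (B τ) t S
        · obtain ⟨S', h1, h2, h3⟩ := exists_large_iUnion (fun n => B (n :: τ)) (B τ) (hB τ)
            (fun n => listIdx (n :: τ)) t S hS hLτ
          refine ⟨S', h1, h2, fun τ' hτ' => ?_⟩
          obtain rfl := Encodable.encode_injective hτ'
          exact Or.inr h3
        · obtain ⟨S', h1, h2, h3⟩ := exists_disjoint_of_not_large hLτ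
          refine ⟨S', h1, h2, fun τ' hτ' => ?_⟩
          obtain rfl := Encodable.encode_injective hτ'
          exact Or.inl h3
      · exact ⟨S, subset_rfl, hS, fun τ hτ => absurd ⟨τ, hτ⟩ hi⟩)
    (fun i t S h τ hτ => by
      rw [ES_above] at h
      rcases h τ hτ with h | h
      · exact Or.inl h
      · refine Or.inr fun a ha => ?_
        obtain ⟨k, n, e1, e2, e3, e4⟩ := h a ha
        exact ⟨k, n, e1, e2, e3, e4.of_above⟩) σ s1 hi1
  refine ⟨s2, h2.trans h1, hi2, fun a ha => ⟨?_, ?_⟩⟩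
  · obtain ⟨k, -, e1, e2, e3, e4⟩ := h a (ES_mono σ h2 ha)
    exact ⟨k + 1, subset_seg_succ ha e1 e2, by rw [sup_seg_succ e1]; exact e3, e4.mono h2⟩
  · rintro m τ ⟨c1, c2, c3⟩
    have hmem := mem_ES_seg ha c1
    rcases hP (seg a m) (seg_eq_or_sup_mem ha c1) (Encodable.encode τ)
      ((le_max_left _ _).trans c2) τ rfl with h | h
    · obtain ⟨b, hb⟩ := c3 s2 subset_rfl hi2
      exact absurd hb (Set.eq_empty_iff_forall_notMem.1 h b)
    · obtain ⟨k, n, e1, e2, e3, e4⟩ := h a hmem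
      have hsub := subset_seg_succ hmem e1 e2
      exact ⟨n, k + 1, c1.trans hsub, by rw [sup_seg_succ e1]; exact e3, e4⟩

/-! ### Complexity of the set of codes -/

theorem exists_isClosed_of_analyticSet {X : Type*} [TopologicalSpace X] [T2Space X] {A : Set X}
    (hA : AnalyticSet A) :
    ∃ F : Set (X × (ℕ → ℕ)), IsClosed F ∧ ∀ x, x ∈ A ↔ ∃ y, (x, y) ∈ F := by
  rw [AnalyticSet] at hA
  rcases hA with rfl | ⟨f, hf, rfl⟩
  · exact ⟨∅, isClosed_empty, by simp⟩
  · refine ⟨{p | f p.2 = p.1}, isClosed_eq (hf.comp continuous_snd) continuous_fst, fun x => ?_⟩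
    rfl

theorem measurable_apply_eq_true {α ι : Type*} [MeasurableSpace α] {s : α → ι → Bool}
    (hs : Measurable s) (i : ι) : Measurable fun p => (s p i = true) := by
  have h : Measurable fun p => s p i := (measurable_pi_apply i).comp hs
  exact h.eq_const true

theorem measurable_infinite : Measurable fun x : ℕ → Bool => {n | x n = true}.Infinite := by
  simp only [Set.infinite_iff_exists_gt, Set.mem_ofPred_eq]
  exact Measurable.forall fun n => Measurable.exists fun m =>
    (measurable_apply_eq_true measurable_id m).and measurable_const

instance : SecondCountableTopology IOI :=
  TopologicalSpace.Subtype.secondCountableTopology _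

instance : StandardBorelSpace IOI :=
  (measurableSet_setOfPred.2 measurable_infinite).standardBorel

theorem isOpen_res_eq (n : ℕ) (l : List ℕ) : IsOpen {y : ℕ → ℕ | PiNat.res y n = l} := by
  by_cases h : ∃ y : ℕ → ℕ, PiNat.res y n = l
  · obtain ⟨y, rfl⟩ := h
    rw [← PiNat.cylinder_eq_res]
    exact PiNat.isOpen_cylinder _ _ _
  · convert isOpen_empty
    exact Set.eq_empty_iff_forall_notMem.2 fun y hy => h ⟨y, hy⟩

theorem measurable_mem_IOI (m : ℕ) : Measurable fun a : IOI => (a.1 m = true) :=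
  measurable_apply_eq_true measurable_subtype_coe m

/-- The points `y` with `res y τ.length = τ` witnessing membership in the section of `F` at `x`. -/
def piece {X : Type*} (F : Set ((X × IOI) × (ℕ → ℕ))) (x : X) (τ : List ℕ) : Set IOI :=
  {a | ∃ y, PiNat.res y τ.length = τ ∧ ((x, a), y) ∈ F}

/-- `D` describes a continuous selection of witnesses `y` with `((x, a), y) ∈ F`,
for `a ∈ [σ,s]`, tested at the pair `(a, y)`. -/
def Selects {X : Type*} (F : Set ((X × IOI) × (ℕ → ℕ))) (x : X) (σ : Finset ℕ) (s : ℕ → Bool)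
    (D : List ℕ × Finset ℕ → Bool) (a : IOI) (y : ℕ → ℕ) : Prop :=
  a ∈ ES σ {n | s n = true} →
    (∃ m, D ([], seg a m) = true) ∧
    (∀ m τ, D (τ, seg a m) = true → ∃ n m', D (n :: τ, seg a m') = true) ∧
    ((∀ n, ∃ m, D (PiNat.res y n, seg a m) = true) → ((x, a), y) ∈ F)

theorem mem_of_selects {X : Type*} {F : Set ((X × IOI) × (ℕ → ℕ))} {x : X} {σ : Finset ℕ}
    {s : ℕ → Bool} {D : List ℕ × Finset ℕ → Bool} {a : IOI} (h : ∀ y, Selects F x σ s D a y)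
    (ha : a ∈ ES σ {n | s n = true}) : ∃ y, ((x, a), y) ∈ F := by
  have h1 := (h 0 ha).1
  have h2 := (h 0 ha).2.1
  have step : ∀ τ : {τ : List ℕ // ∃ m, D (τ, seg a m) = true},
      ∃ n, ∃ m', D (n :: τ.1, seg a m') = true := fun ⟨τ, m, hm⟩ => h2 m τ hm
  choose next hnext using step
  let l : ℕ → {τ : List ℕ // ∃ m, D (τ, seg a m) = true} := fun n =>
    Nat.rec ⟨[], h1⟩ (fun _ τ => ⟨next τ :: τ.1, hnext τ⟩) n
  have hl : ∀ n, PiNat.res (fun n => next (l n)) n = (l n).1 := by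
    intro n
    induction n with
    | zero => rfl
    | succ n ih => rw [PiNat.res_succ, ih]
  exact ⟨_, (h _ ha).2.2 fun n => by rw [hl]; exact (l n).2⟩

theorem piece_subset_iUnion {X : Type*} (F : Set ((X × IOI) × (ℕ → ℕ))) (x : X) (τ : List ℕ) :
    piece F x τ ⊆ ⋃ n, piece F x (n :: τ) := by
  rintro a ⟨y, hy, hF⟩
  refine Set.mem_iUnion.2 ⟨y τ.length, y, ?_, hF⟩
  rw [List.length_cons, PiNat.res_succ, hy]

theorem mem_of_certified {X : Type*} [TopologicalSpace X] {F : Set ((X × IOI) × (ℕ → ℕ))}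
    (hF : IsClosed F) {x : X} {s : Set ℕ} (hs : s.Infinite) {σ : Finset ℕ} {a : IOI} {y : ℕ → ℕ}
    (h : ∀ n, ∃ m, Certified (piece F x) s σ (PiNat.res y n) (seg a m)) : ((x, a), y) ∈ F := by
  have key : ∀ n, ∃ (b : IOI) (z : ℕ → ℕ), ((x, b), z) ∈ F ∧ (∀ j < n, b.1 j = a.1 j) ∧
      ∀ j < n, z j = y j := by
    intro n
    obtain ⟨m, -, hidx, hL⟩ := h n
    obtain ⟨b, hb, z, hz, hzF⟩ := hL s subset_rfl hs
    rw [PiNat.res_length] at hz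
    refine ⟨b, z, hzF, fun j hj => ?_, PiNat.res_eq_res.1 hz⟩
    have hn : n ≤ (seg a m).sup id := by
      refine le_trans ?_ hidx
      conv_lhs => rw [← PiNat.res_length y n]
      exact le_max_right _ _
    have hne : (seg a m).Nonempty := by
      rw [Finset.nonempty_iff_ne_empty]
      intro h0
      rw [h0] at hn
      simp at hn
      omega
    obtain ⟨k, hk, hk'⟩ := Finset.exists_mem_eq_sup (seg a m) hne id
    rw [hk'] at hn
    simp only [id] at hn
    have hkm := (mem_seg.1 hk).1
    cases haj : a.1 j
    · by_contra hbj
      have hjn : j ∉ seg a m := fun h' => by simp [(mem_seg.1 h').2] at haj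
      have := (hb.2 j (by simpa using hbj) hjn).2 k hk
      omega
    · exact hb.1 j (mem_seg.2 ⟨by omega, haj⟩)
  choose b z hbz hb hz using key
  have hbl : Filter.Tendsto b Filter.atTop (nhds a) := by
    rw [tendsto_subtype_rng, tendsto_pi_nhds]
    intro j
    refine tendsto_const_nhds.congr' ?_
    filter_upwards [Filter.eventually_gt_atTop j] with n hn
    exact (hb n j hn).symm
  have hzl : Filter.Tendsto z Filter.atTop (nhds y) := by
    rw [tendsto_pi_nhds]
    intro j
    refine tendsto_const_nhds.congr' ?_
    filter_upwards [Filter.eventually_gt_atTop j] with n hn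
    exact (hz n j hn).symm
  exact hF.mem_of_tendsto ((tendsto_const_nhds.prodMk_nhds hbl).prodMk_nhds hzl)
    (Filter.Eventually.of_forall hbz)

/-- A section of a projection of a closed set is Ramsey positive iff some `[σ,s]` carries a
continuous selection of witnesses. -/
theorem ramseyPositive_section_iff {X : Type*} [TopologicalSpace X]
    {F : Set ((X × IOI) × (ℕ → ℕ))} (hF : IsClosed F) (x : X) :
    RamseyPositive {a | ∃ y, ((x, a), y) ∈ F} ↔
      ∃ (σ : Finset ℕ) (s : ℕ → Bool) (D : List ℕ × Finset ℕ → Bool),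
        {n | s n = true}.Infinite ∧ ∀ a y, Selects F x σ s D a y := by
  classical
  rw [ramseyPositive_iff]
  constructor
  · rintro ⟨σ, s, hs, hL⟩
    have hA : {a | ∃ y, ((x, a), y) ∈ F} = piece F x [] := by
      ext a
      simp [piece]
    rw [hA] at hL
    obtain ⟨s', -, hi', h⟩ := exists_certified (piece F x) (piece_subset_iUnion F x) σ s hs hL
    have hset : {n | decide (n ∈ s') = true} = s' := by simp
    refine ⟨σ, fun n => decide (n ∈ s'), fun q => decide (Certified (piece F x) s' σ q.1 q.2),
      by rw [hset]; exact hi', fun a y ha => ?_⟩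
    rw [hset] at ha
    simp only [decide_eq_true_eq]
    exact ⟨(h a ha).1, (h a ha).2, mem_of_certified hF hi'⟩
  · rintro ⟨σ, s, D, hs, h⟩
    refine ⟨σ, _, hs, fun s' hs' hi' => ?_⟩
    have hg : Set.Infinite {n | decide (n ∈ σ ∪ ∅ ∨ n ∈ above σ s') = true} := by
      refine (above_infinite σ hi').mono fun n hn => ?_
      simp [hn]
    let a : IOI := ⟨fun n => decide (n ∈ σ ∪ ∅ ∨ n ∈ above σ s'), hg⟩
    have ha : a ∈ ES σ s' := by
      refine ⟨fun m hm => by simp [a, hm], fun n hn hnσ => ?_⟩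
      simp only [a, decide_eq_true_eq, Finset.union_empty, hnσ, false_or] at hn
      exact hn
    exact ⟨a, ha, mem_of_selects (h a) (ES_mono σ hs' ha)⟩

theorem measurable_of_countable_cases {α β : Type*} [MeasurableSpace α] [Countable β] {g : α → β}
    {R : β → α → Prop} (hg : ∀ b, Measurable fun p => (g p = b)) (hR : ∀ b, Measurable (R b)) :
    Measurable fun p => R (g p) p := by
  have : (fun p => R (g p) p) = fun p => ∃ b, g p = b ∧ R b p := by
    ext p
    simp
  rw [this]
  exact Measurable.exists fun b => (hg b).and (hR b)

theorem measurable_seg_eq (m : ℕ) (t : Finset ℕ) : Measurable fun a : IOI => (seg a m = t) := by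
  have : (fun a : IOI => (seg a m = t)) = fun a => ∀ j, (j < m ∧ a.1 j = true) ↔ j ∈ t := by
    ext a
    rw [Finset.ext_iff]
    simp only [mem_seg]
  rw [this]
  exact Measurable.forall fun j =>
    (measurable_const.and (measurable_mem_IOI j)).iff measurable_const

theorem measurable_res_eq (n : ℕ) (l : List ℕ) :
    Measurable fun y : ℕ → ℕ => (PiNat.res y n = l) :=
  measurableSet_setOfPred.1 (isOpen_res_eq n l).measurableSet

theorem measurable_selects {F : Set (((ℕ → Bool) × IOI) × (ℕ → ℕ))} (hF : IsClosed F)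
    {α : Type*} [MeasurableSpace α] {x : α → ℕ → Bool} {σ : α → Finset ℕ} {s : α → ℕ → Bool}
    {D : α → List ℕ × Finset ℕ → Bool} {a : α → IOI} {y : α → ℕ → ℕ} (hx : Measurable x)
    (hσ : ∀ t, Measurable fun p => (σ p = t)) (hs : Measurable s) (hD : Measurable D)
    (ha : Measurable a) (hy : Measurable y) :
    Measurable fun p => Selects F (x p) (σ p) (s p) (D p) (a p) (y p) := by
  have hD' : ∀ τ m, Measurable fun p => (D p (τ, seg (a p) m) = true) := fun τ m =>
    measurable_of_countable_cases (g := fun p => seg (a p) m)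
      (R := fun t p => D p (τ, t) = true) (fun t => (measurable_seg_eq m t).comp ha)
      fun t => measurable_apply_eq_true hD _
  have hmem : ∀ m, Measurable fun p => ((a p).1 m = true) := fun m => (measurable_mem_IOI m).comp ha
  refine Measurable.imp ?_ (Measurable.and ?_ (Measurable.and ?_ (Measurable.imp ?_ ?_)))
  · refine measurable_of_countable_cases (g := σ)
      (R := fun t p => a p ∈ ES t {n | s p n = true}) hσ fun t => ?_
    refine Measurable.and (Measurable.forall fun m => measurable_const.imp (hmem m)) ?_
    refine Measurable.forall fun n => (hmem n).imp (measurable_const.imp ?_)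
    exact (measurable_apply_eq_true hs n).and measurable_const
  · exact Measurable.exists fun m => hD' _ m
  · exact Measurable.forall fun m => Measurable.forall fun τ =>
      (hD' _ m).imp (Measurable.exists fun n => Measurable.exists fun m' => hD' _ m')
  · refine Measurable.forall fun n => Measurable.exists fun m => ?_
    exact measurable_of_countable_cases (g := fun p => PiNat.res (y p) n)
      (R := fun l p => D p (l, seg (a p) m) = true) (fun l => (measurable_res_eq n l).comp hy)
      fun l => hD' l m
  · have hm : Measurable fun p => ((x p, a p), y p) := (hx.prodMk ha).prodMk hy
    exact measurableSet_setOfPred.1 (hm hF.measurableSet)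

instance polishSpace_pi_bool {ι : Type*} [Countable ι] : PolishSpace (ι → Bool) where

theorem sigma12_ramseyPositive {U : Set ((ℕ → Bool) × IOI)} (hU : AnalyticSet U) :
    Sigma12 {x : ℕ → Bool | RamseyPositive {a : IOI | (x, a) ∈ U}} := by
  obtain ⟨F, hF, hUF⟩ := exists_isClosed_of_analyticSet hU
  obtain ⟨φ, hφ, hφs⟩ := PolishSpace.exists_nat_nat_continuous_surjective
      ((ℕ → Bool) × ℕ × (ℕ → Bool) × (List ℕ × Finset ℕ → Bool))
  obtain ⟨κ, hκ⟩ := exists_surjective_nat (Finset ℕ)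
  let σ : (ℕ → ℕ) → Finset ℕ := fun c => κ (φ c).2.1
  let R : ((ℕ → ℕ) × IOI × (ℕ → ℕ)) → Prop := fun p =>
    {n | (φ p.1).2.2.1 n = true}.Infinite ∧
      Selects F (φ p.1).1 (σ p.1) (φ p.1).2.2.1 (φ p.1).2.2.2 p.2.1 p.2.2
  have hR : Measurable R := by
    have hφm : Measurable fun p : (ℕ → ℕ) × IOI × (ℕ → ℕ) => φ p.1 :=
      hφ.measurable.comp measurable_fst
    refine Measurable.and ?_ (measurable_selects hF hφm.fst ?_ hφm.snd.snd.fst hφm.snd.snd.snd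
      measurable_snd.fst measurable_snd.snd)
    · exact measurable_infinite.comp hφm.snd.snd.fst
    · intro t
      exact measurable_of_countable_cases (g := fun p : (ℕ → ℕ) × IOI × (ℕ → ℕ) => (φ p.1).2.1)
        (R := fun k _ => κ k = t)
        (fun b => Measurable.eq_const hφm.snd.fst b) fun b => measurable_const
  refine ⟨{c | ∀ q, R (c, q)}, fun c => (φ c).1, ?_, continuous_fst.comp hφ, ?_⟩
  · have : {c | ∀ q, R (c, q)}ᶜ = Prod.fst '' {p | ¬ R p} := by
      ext c
      simp
    rw [this]
    exact (measurableSet_setOfPred.2 hR.not).analyticSet_image measurable_fst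
  · ext x
    have hsec : {a : IOI | (x, a) ∈ U} = {a | ∃ y, ((x, a), y) ∈ F} := by
      ext a
      exact hUF _
    rw [Set.mem_ofPred_eq, hsec, ramseyPositive_section_iff hF]
    constructor
    · rintro ⟨c, hc, rfl⟩
      obtain ⟨a0⟩ : Nonempty IOI := ⟨⟨fun _ => true, by simpa using Set.infinite_univ⟩⟩
      exact ⟨σ c, (φ c).2.2.1, (φ c).2.2.2, (hc (a0, 0)).1, fun a y => (hc (a, y)).2⟩
    · rintro ⟨t, s, D, hs, h⟩
      obtain ⟨k, rfl⟩ := hκ t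
      obtain ⟨c, hc⟩ := hφs (x, k, s, D)
      refine ⟨c, fun q => ?_, by simp [hc]⟩
      simp only [R, σ, hc]
      exact ⟨hs, h q.1 q.2⟩

/-! ### A well-parametrized universal analytic set -/

theorem exists_seq_of_isTopologicalBasis {X : Type*} [TopologicalSpace X]
    [SecondCountableTopology X] {b : Set (Set X)} (hb : IsTopologicalBasis b) :
    ∃ W : ℕ → Set X, (∀ n, W n ∈ insert ∅ b) ∧
      ∀ O, IsOpen O → ∀ x ∈ O, ∃ n, x ∈ W n ∧ W n ⊆ O := by
  obtain ⟨c, hcb, hc, hbasis⟩ := hb.exists_countable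
  obtain ⟨W, hW⟩ := (hc.insert ∅).exists_eq_range (Set.insert_nonempty _ _)
  refine ⟨W, fun n => ?_, fun O hO x hx => ?_⟩
  · have : W n ∈ insert ∅ c := hW ▸ Set.mem_range_self n
    exact Set.insert_subset_insert hcb this
  · obtain ⟨w, hw, hxw, hwO⟩ := hbasis.exists_subset_of_mem_open hx hO
    obtain ⟨n, rfl⟩ : w ∈ Set.range W := hW ▸ Set.mem_insert_of_mem _ hw
    exact ⟨n, hxw, hwO⟩

theorem exists_universal : ∃ U : Set ((ℕ → Bool) × IOI), AnalyticSet U ∧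
    ∀ (Z : Type) [TopologicalSpace Z] [T2Space Z] [SecondCountableTopology Z], ZeroDim Z →
      ∀ V : Set (Z × IOI), AnalyticSet V →
        ∃ f : Z → ℕ → Bool, Continuous f ∧ ∀ z a, (f z, a) ∈ U ↔ (z, a) ∈ V := by
  classical
  obtain ⟨W, hWb, hW⟩ := exists_seq_of_isTopologicalBasis
    (isTopologicalBasis_opens (α := IOI × (ℕ → ℕ)))
  have hWo : ∀ n, IsOpen (W n) := fun n => by
    rcases hWb n with h | h
    · rw [h]
      exact isOpen_empty
    · exact h
  let E : Set (((ℕ → Bool) × IOI) × (ℕ → ℕ)) :=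
    {p | ∀ j, p.1.1 j = true → (p.1.2, p.2) ∉ W (Nat.unpair j).1}
  refine ⟨{q | ∃ y, (q, y) ∈ E}, ?_, ?_⟩
  · have hE : MeasurableSet E := by
      refine measurableSet_setOfPred.2 (Measurable.forall fun j => Measurable.imp ?_ ?_)
      · exact measurable_apply_eq_true measurable_fst.fst j
      · have hm : Measurable fun p : ((ℕ → Bool) × IOI) × (ℕ → ℕ) => (p.1.2, p.2) :=
          measurable_fst.snd.prodMk measurable_snd
        exact (measurableSet_setOfPred.1 (hm (hWo _).measurableSet)).not
    convert hE.analyticSet_image measurable_fst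
    ext q
    simp
  · intro Z _ _ _ ⟨b, hbc, hb⟩ V hV
    obtain ⟨Q, hQb, hQ⟩ := exists_seq_of_isTopologicalBasis hb
    have hQc : ∀ n, IsClopen (Q n) := fun n => by
      rcases hQb n with h | h
      · rw [h]
        exact isClopen_empty
      · exact hbc _ h
    obtain ⟨F, hF, hVF⟩ := exists_isClosed_of_analyticSet hV
    let G : ℕ → Prop := fun j =>
      ∀ z a y, z ∈ Q (Nat.unpair j).2 → (a, y) ∈ W (Nat.unpair j).1 → ((z, a), y) ∉ F
    refine ⟨fun z j => decide (z ∈ Q (Nat.unpair j).2 ∧ G j), ?_, fun z a => ?_⟩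
    · refine continuous_pi fun j => ?_
      by_cases hG : G j
      · simp only [hG, and_true]
        exact (continuous_bool_rng true).2 (by
          convert hQc (Nat.unpair j).2 using 1
          ext z
          simp)
      · simp only [hG, and_false]
        exact continuous_const
    · rw [hVF]
      refine exists_congr fun y => ?_
      constructor
      · intro h
        by_contra hzF
        have hpre : IsOpen {p : Z × (IOI × (ℕ → ℕ)) | ((p.1, p.2.1), p.2.2) ∈ F}ᶜ :=
          (hF.preimage (by fun_prop)).isOpen_compl
        obtain ⟨O₁, O₂, hO₁, hO₂, hz, hay, hsub⟩ := isOpen_prod_iff.1 hpre z (a, y) hzF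
        obtain ⟨n, hn, hnO⟩ := hQ O₁ hO₁ z hz
        obtain ⟨i, hi, hiO⟩ := hW O₂ hO₂ (a, y) hay
        refine h (Nat.pair i n) ?_ ?_
        · simp only [Nat.unpair_pair, decide_eq_true_eq, G]
          exact ⟨hn, fun z' a' y' h1 h2 => hsub (Set.mk_mem_prod (hnO h1) (hiO h2))⟩
        · simpa using hi
      · intro h j hj hmem
        simp only [decide_eq_true_eq] at hj
        exact hj.2 z a y hj.1 hmem h

/-! ### Hardness -/

/-- The set of codes of the finite initial segments of `y`. -/
def branchSet (y : ℕ → ℕ) : Set ℕ := Set.range fun n => Encodable.encode (PiNat.res y n)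

theorem branchSet_infinite (y : ℕ → ℕ) : (branchSet y).Infinite := by
  refine Set.infinite_range_of_injective fun i j hij => ?_
  have := congrArg List.length (Encodable.encode_injective hij)
  simpa using this

theorem eq_of_infinite_inter {y z : ℕ → ℕ} (h : (branchSet y ∩ branchSet z).Infinite) : y = z := by
  funext i
  obtain ⟨m, ⟨⟨n, hn⟩, ⟨k, hk⟩⟩, hm⟩ := (h.sdiff ((Finset.range (i + 1)).image fun n =>
    Encodable.encode (PiNat.res y n)).finite_toSet).nonempty
  have hni : i < n := by
    by_contra hle
    refine hm ?_
    simp only [Finset.coe_image, Set.mem_image]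
    exact ⟨n, by simp; omega, hn⟩
  have heq : PiNat.res y n = PiNat.res z k := Encodable.encode_injective (hn.trans hk.symm)
  have hlen : n = k := by simpa using congrArg List.length heq
  subst hlen
  exact PiNat.res_eq_res.1 heq hni

theorem measurable_mem_branchSet (m : ℕ) : Measurable fun y => m ∈ branchSet y := by
  refine Measurable.exists fun n => ?_
  exact measurable_of_countable_cases (g := fun y => PiNat.res y n)
    (R := fun l _ => Encodable.encode l = m) (measurable_res_eq n) fun _ => measurable_const

theorem isClosed_exists_le {F : Set ((ℕ → ℕ) × (ℕ → ℕ))} (hF : IsClosed F) :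
    IsClosed {p : (ℕ → ℕ) × (ℕ → ℕ) | ∃ b ≤ p.2, (p.1, b) ∈ F} := by
  refine IsSeqClosed.isClosed fun p q hp hpq => ?_
  choose b hb hbF using hp
  have h1 := (continuous_fst.tendsto q).comp hpq
  have h2 := (continuous_snd.tendsto q).comp hpq
  have hbdd : ∀ i, ∃ M, ∀ n, (p n).2 i ≤ M := fun i => by
    obtain ⟨M, hM⟩ := ((tendsto_pi_nhds.1 h2) i).bddAbove_range
    exact ⟨M, fun n => hM (Set.mem_range_self n)⟩
  choose H hH using hbdd
  have hK : IsCompact (Set.pi Set.univ fun i => Set.Iic (H i)) :=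
    isCompact_univ_pi fun i => (Set.finite_Iic (H i)).isCompact
  obtain ⟨c, -, φ, hφ, hc⟩ := hK.tendsto_subseq (x := b)
    fun n i _ => (hb n i).trans (hH i n)
  exact ⟨c, le_of_tendsto_of_tendsto' hc (h2.comp hφ.tendsto_atTop) fun n => hb (φ n),
    hF.mem_of_tendsto ((h1.comp hφ.tendsto_atTop).prodMk_nhds hc)
      (Filter.Eventually.of_forall fun n => hbF (φ n))⟩

theorem exists_strictMono_ge {s : Set ℕ} (hs : s.Infinite) (b : ℕ → ℕ) :
    ∃ m : ℕ → ℕ, StrictMono m ∧ ∀ n, m n ∈ s ∧ b n ≤ m n := by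
  refine Filter.extraction_forall_of_frequently (P := fun n k => k ∈ s ∧ b n ≤ k) fun n => ?_
  rw [Nat.frequently_atTop_iff_infinite]
  refine (hs.sdiff (Set.finite_Iio (b n))).mono ?_
  rintro k ⟨hk, hk'⟩
  exact ⟨hk, by simpa using hk'⟩

/-- The set `a` lies on the branch `y`, and its enumeration `e` dominates no witness of
`y ∈ p[F]`, even after shifts. -/
def Escapes (F : Set ((ℕ → ℕ) × (ℕ → ℕ))) (a : IOI) (y e : ℕ → ℕ) : Prop :=
  StrictMono e ∧ (∀ n, a.1 (e n) = true) ∧ (∀ m, a.1 m = true → m ∈ branchSet y) ∧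
    ∀ k, ¬ ∃ b ≤ fun n => e (n + k), (y, b) ∈ F

theorem measurable_escapes {F : Set ((ℕ → ℕ) × (ℕ → ℕ))} (hF : IsClosed F) :
    Measurable fun p : IOI × (ℕ → ℕ) × (ℕ → ℕ) => Escapes F p.1 p.2.1 p.2.2 := by
  have he : ∀ n, Measurable fun p : IOI × (ℕ → ℕ) × (ℕ → ℕ) => p.2.2 n :=
    fun n => (measurable_pi_apply n).comp measurable_snd.snd
  refine Measurable.and ?_ (Measurable.and (Measurable.forall fun n => ?_)
    (Measurable.and (Measurable.forall fun m => Measurable.imp ?_ ?_)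
      (Measurable.forall fun k => Measurable.not ?_)))
  · have : (fun p : IOI × (ℕ → ℕ) × (ℕ → ℕ) => StrictMono p.2.2) =
        fun p => ∀ n, p.2.2 n < p.2.2 (n + 1) := by
      ext p
      exact ⟨fun h n => h (Nat.lt_succ_self n), strictMono_nat_of_lt_succ⟩
    rw [this]
    exact Measurable.forall fun n => measurableSet_setOfPred.1 (measurableSet_lt (he n) (he (n + 1)))
  · exact measurable_of_countable_cases (g := fun p : IOI × (ℕ → ℕ) × (ℕ → ℕ) => p.2.2 n)
      (R := fun m p => p.1.1 m = true) (fun m => (he n).eq_const m)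
      fun m => (measurable_mem_IOI m).comp measurable_fst
  · exact (measurable_mem_IOI m).comp measurable_fst
  · exact (measurable_mem_branchSet m).comp measurable_snd.fst
  · have hm : Measurable fun p : IOI × (ℕ → ℕ) × (ℕ → ℕ) => (p.2.1, fun n => p.2.2 (n + k)) :=
      measurable_snd.fst.prodMk (measurable_pi_iff.2 fun n => he (n + k))
    exact measurableSet_setOfPred.1 (hm (isClosed_exists_le hF).measurableSet)

theorem exists_IOI {s : Set ℕ} (hs : s.Infinite) : ∃ a : IOI, ∀ n, a.1 n = true ↔ n ∈ s := by
  classical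
  exact ⟨⟨fun n => decide (n ∈ s), by simpa using hs⟩, fun n => by simp⟩

theorem ramseyPositive_escapes_iff {Z : Type*} (f : (ℕ → ℕ) → Z)
    (F : Set ((ℕ → ℕ) × (ℕ → ℕ))) (z : Z) :
    RamseyPositive {a | ∃ y e, f y = z ∧ Escapes F a y e} ↔
      ∃ y, f y = z ∧ ¬ ∃ b, (y, b) ∈ F := by
  rw [ramseyPositive_iff]
  constructor
  · rintro ⟨σ, s, hs, hL⟩
    obtain ⟨a, ha, y, -, hfy, -, -, hay, -⟩ := hL s subset_rfl hs
    refine ⟨y, hfy, ?_⟩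
    rintro ⟨b, hb⟩
    have hinf : ({n | a.1 n = true} \ (σ : Set ℕ)).Infinite := a.2.sdiff σ.finite_toSet
    obtain ⟨m, hm, hmb⟩ := exists_strictMono_ge hinf b
    obtain ⟨c, hc, y', e, -, he, hec, hcy, hesc⟩ := hL (Set.range m)
      (by
        rintro _ ⟨n, rfl⟩
        exact (ha.2 _ (hmb n).1.1 (hmb n).1.2).1) (Set.infinite_range_of_injective hm.injective)
    have hyy : y' = y := by
      refine eq_of_infinite_inter ((c.2.sdiff σ.finite_toSet).mono ?_)
      rintro n ⟨hn, hnσ⟩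
      refine ⟨hcy n hn, ?_⟩
      obtain ⟨j, rfl⟩ := (hc.2 n hn hnσ).1
      exact hay _ (hmb j).1.1
    subst hyy
    have hrange : ∀ n, ∃ j, m j = e (n + (σ.sup id + 1)) := fun n => by
      refine (hc.2 _ (hec _) fun hmem => ?_).1
      have h1 : e (n + (σ.sup id + 1)) ≤ σ.sup id := Finset.le_sup (f := id) hmem
      have h2 := he.le_apply (x := n + (σ.sup id + 1))
      omega
    choose j hj using hrange
    have hjm : StrictMono j := fun n n' hnn => hm.lt_iff_lt.1 (by
      rw [hj, hj]
      exact he (by omega))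
    refine hesc (σ.sup id + 1) ⟨b, fun n => ?_, hb⟩
    calc b n ≤ m n := (hmb n).2
      _ ≤ m (j n) := hm.monotone hjm.le_apply
      _ = e (n + (σ.sup id + 1)) := hj n
  · rintro ⟨y, hfy, hy⟩
    refine ⟨∅, branchSet y, branchSet_infinite y, fun s hs hi => ?_⟩
    obtain ⟨a, ha⟩ := exists_IOI hi
    obtain ⟨e, he, hes⟩ := exists_strictMono_ge hi 0
    refine ⟨a, ⟨by simp, fun n hn _ => ⟨(ha n).1 hn, by simp⟩⟩, y, e, hfy, he,
      fun n => (ha _).2 (hes n).1, fun m hm => hs ((ha m).1 hm), fun k => ?_⟩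
    rintro ⟨b, -, hb⟩
    exact hy ⟨b, hb⟩

theorem exists_analyticSet_ramseyPositive_iff {Z : Type} [TopologicalSpace Z] [PolishSpace Z]
    {B : Set Z} (hB : Sigma12 B) : ∃ V : Set (Z × IOI), AnalyticSet V ∧
      ∀ z, RamseyPositive {a | (z, a) ∈ V} ↔ z ∈ B := by
  obtain ⟨C, f, hC, hf, rfl⟩ := hB
  obtain ⟨F, hF, hCF⟩ := exists_isClosed_of_analyticSet hC
  refine ⟨{p | ∃ y e, f y = p.1 ∧ Escapes F p.2 y e}, ?_, fun z => ?_⟩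
  · borelize Z
    have hm : MeasurableSet {q : (Z × IOI) × (ℕ → ℕ) × (ℕ → ℕ) |
        f q.2.1 = q.1.1 ∧ Escapes F q.1.2 q.2.1 q.2.2} := by
      refine measurableSet_setOfPred.2 (Measurable.and ?_ ?_)
      · exact measurableSet_setOfPred.1
          (measurableSet_eq_fun (hf.measurable.comp measurable_snd.fst) measurable_fst.fst)
      · exact (measurable_escapes hF).comp (measurable_fst.snd.prodMk measurable_snd)
    convert hm.analyticSet_image measurable_fst
    ext p
    simp
  · refine (ramseyPositive_escapes_iff f F z).trans (exists_congr fun y => ?_)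
    rw [← hCF, Set.mem_compl_iff, not_not, and_comm]

theorem zeroDim_unit : ZeroDim Unit :=
  ⟨{s | IsOpen s}, fun _ _ => isClopen_discrete _, isTopologicalBasis_opens⟩

/-- There is an analytic set `U ⊆ 2^ℕ × [ω]^ω` universal for analytic subsets of
`[ω]^ω` such that the set of codes of Ramsey-positive sections is `Σ¹₂`-complete. -/
theorem statement0 :
    ∃ U : Set ((ℕ → Bool) × IOI),
      AnalyticSet U ∧
      (∀ A : Set IOI, AnalyticSet A → ∃ x : ℕ → Bool, {a : IOI | (x, a) ∈ U} = A) ∧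
      Sigma12Complete {x : ℕ → Bool | RamseyPositive {a : IOI | (x, a) ∈ U}} := by
  obtain ⟨U, hU, huniv⟩ := exists_universal
  refine ⟨U, hU, fun A hA => ?_, sigma12_ramseyPositive hU, fun Z _ _ hZ B hB => ?_⟩
  · obtain ⟨f, -, hf⟩ := huniv Unit zeroDim_unit (Prod.mk () '' A)
      (hA.image_of_continuous (Continuous.prodMk_right ()))
    exact ⟨f (), Set.ext fun a => (hf () a).trans (by simp)⟩
  · obtain ⟨V, hV, hVB⟩ := exists_analyticSet_ramseyPositive_iff hB
    obtain ⟨f, hfc, hf⟩ := huniv Z hZ V hV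
    refine ⟨f, hfc, Set.ext fun z => ?_⟩
    rw [← hVB]
    simp only [Set.mem_preimage, Set.mem_ofPred_eq, hf]
end

section
/- The set {z ∈ 𝒞 : G_z is Ramsey positive} of codes of Ramsey positive G_δ subsets of [ω]^ω is (Σ¹₂,Σ¹₁∪Π¹₁)-complete with respect to the fixed subbase of 𝒞. -/
open MeasureTheory TopologicalSpace

/-- `f` is `Σ¹₁∪Π¹₁`-submeasurable with respect to the subbase `U` of the target:
the preimage of every subbasic set is analytic or coanalytic. -/
def Submeasurable {Z X : Type*} [TopologicalSpace Z] {ι : Type*} (U : ι → Set X)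
    (f : Z → X) : Prop :=
  ∀ i, AnalyticSet (f ⁻¹' U i) ∨ AnalyticSet (f ⁻¹' U i)ᶜ

/-- `A` is `(Σ¹₂,Σ¹₁∪Π¹₁)`-complete with respect to the subbase `U`: `A` is `Σ¹₂` and
every `Σ¹₂` subset of a zero-dimensional Polish space is a preimage of `A` under a
`Σ¹₁∪Π¹₁`-submeasurable map. -/
def SubComplete {X : Type*} [TopologicalSpace X] {ι : Type*} (U : ι → Set X)
    (A : Set X) : Prop :=
  Sigma12 A ∧
  ∀ (Z : Type) [TopologicalSpace Z] [PolishSpace Z], ZeroDim Z →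
    ∀ B : Set Z, Sigma12 B → ∃ f : Z → X, Submeasurable U f ∧ f ⁻¹' A = B

/-- A pruned tree of strictly increasing finite sequences of naturals: nonempty
(contains the empty sequence), all members strictly increasing, closed under
initial segments, and every member has a proper extension in the tree. -/
def PrunedIncTree (T : List ℕ → Bool) : Prop :=
  T [] = true ∧
  (∀ l, T l = true → List.Chain' (· < ·) l) ∧
  (∀ l n, T (l ++ [n]) = true → T l = true) ∧
  (∀ l, T l = true → ∃ n, T (l ++ [n]) = true)

/-- The initial segment of length `k` of the increasing enumeration of `a ∈ [ω]^ω`. -/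
noncomputable def enumList (a : IOI) (k : ℕ) : List ℕ :=
  (List.range k).map (Nat.nth fun n => a.1 n = true)

/-- The closed set `C_T ⊆ [ω]^ω` coded by `T`: all `a` all of whose
increasing-enumeration initial segments lie in `T`. -/
def treeClosedSet (T : List ℕ → Bool) : Set IOI :=
  {a | ∀ k, T (enumList a k) = true}

/-- The space `𝒞` of `G_δ`-codes: sequences of pruned trees of strictly increasing
finite sequences, topologized as a subspace of `(2^(ℕ^{<ℕ}))^ℕ`. -/
abbrev GdCode := {z : ℕ → List ℕ → Bool // ∀ n, PrunedIncTree (z n)}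

/-- The `G_δ` set coded by `z`: `G_z = [ω]^ω \ ⋃ n, C_{T_n}`. -/
def Gdelta (z : GdCode) : Set IOI := (⋃ n, treeClosedSet (z.1 n))ᶜ

/-- The fixed countable subbase of `𝒞`: the sets `{z : σ ∈ T_{z,n}}` and
`{z : σ ∉ T_{z,n}}` for `n ∈ ℕ` and finite strictly increasing `σ`. -/
def codeSubbase : ℕ × {σ : List ℕ // List.Chain' (· < ·) σ} × Bool → Set GdCode :=
  fun p => {z | z.1 p.1 p.2.1.1 = p.2.2}

namespace RamseyCode

/-- The subset of `ℕ` with characteristic function `b`. -/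
def supp (b : IOI) : Set ℕ := {n | b.1 n = true}

theorem supp_infinite (b : IOI) : (supp b).Infinite := b.2

/-- The finite set of elements of `b` below `N`. -/
def below (b : IOI) (N : ℕ) : Finset ℕ := (Finset.range N).filter fun n => b.1 n = true

theorem mem_below {b : IOI} {N n : ℕ} : n ∈ below b N ↔ n < N ∧ n ∈ supp b := by
  simp [below, supp]

/-! ### Cylinders -/

theorem exists_cylinder_subset {E : Type*} [TopologicalSpace E] [DiscreteTopology E]
    {U : Set (ℕ → E)} (hU : IsOpen U) {x : ℕ → E} (hx : x ∈ U) :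
    ∃ N, ∀ ⦃y : ℕ → E⦄, (∀ k < N, y k = x k) → y ∈ U := by
  obtain ⟨I, u, hu, hI⟩ := isOpen_pi_iff.1 hU x hx
  obtain ⟨N, hN⟩ : ∃ N, ∀ m ∈ I, m < N :=
    ⟨I.sup id + 1, fun _ hm => Nat.lt_succ_of_le (Finset.le_sup (f := id) hm)⟩
  refine ⟨N, fun y hy => hI fun k hk => ?_⟩
  rw [hy k (hN k hk)]
  exact (hu k hk).2

theorem isOpen_of_cylinder {E : Type*} [TopologicalSpace E] [DiscreteTopology E]
    {U : Set (ℕ → E)} (h : ∀ x ∈ U, ∃ N, ∀ y : ℕ → E, (∀ k < N, y k = x k) → y ∈ U) :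
    IsOpen U := by
  refine isOpen_iff_mem_nhds.2 fun x hx => ?_
  obtain ⟨N, hN⟩ := h x hx
  exact Filter.mem_of_superset
    ((PiNat.isOpen_cylinder (fun _ => E) x N).mem_nhds (PiNat.self_mem_cylinder x N)) hN

/-! ### Ellentuck basic sets -/

theorem es_mono {σ : Finset ℕ} {s t : Set ℕ} (h : s ⊆ t) : ES σ s ⊆ ES σ t :=
  fun _ ha => ⟨ha.1, fun n hn hσ => ⟨h (ha.2 n hn hσ).1, (ha.2 n hn hσ).2⟩⟩

theorem es_sep (σ : Finset ℕ) (s : Set ℕ) : ES σ {n ∈ s | ∀ m ∈ σ, m < n} = ES σ s := by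
  refine (es_mono (Set.sep_subset _ _)).antisymm fun a ha => ⟨ha.1, fun n hn hσ => ?_⟩
  exact ⟨ha.2 n hn hσ, (ha.2 n hn hσ).2⟩

theorem infinite_sep_above (σ : Finset ℕ) {s : Set ℕ} (hs : s.Infinite) :
    {n ∈ s | ∀ m ∈ σ, m < n}.Infinite := by
  refine (hs.sdiff (Set.finite_Iic (σ.sup id))).mono fun n hn => ⟨hn.1, fun m hm => ?_⟩
  exact (Finset.le_sup (f := id) hm).trans_lt (not_le.1 hn.2)

theorem es_nonempty (σ : Finset ℕ) {s : Set ℕ} (hs : s.Infinite) : (ES σ s).Nonempty := by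
  classical
  refine ⟨⟨fun n => decide (n ∈ σ ∨ (n ∈ s ∧ ∀ m ∈ σ, m < n)), ?_⟩, ?_, ?_⟩
  · exact (infinite_sep_above σ hs).mono fun n hn => by simpa using Or.inr hn
  · intro m hm
    simp [hm]
  · intro n hn hσ
    simpa [hσ] using hn

theorem mem_es_below {b c : IOI} {N : ℕ} :
    c ∈ ES (below b N) (supp b) ↔ (∀ k < N, c.1 k = b.1 k) ∧ supp c ⊆ supp b := by
  constructor
  · rintro ⟨h1, h2⟩
    have hsub : supp c ⊆ supp b := fun n hn => by
      by_cases h : n ∈ below b N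
      · exact (mem_below.1 h).2
      · exact (h2 n hn h).1
    refine ⟨fun k hk => ?_, hsub⟩
    rw [Bool.eq_iff_iff]
    exact ⟨fun h => hsub h, fun h => h1 k (mem_below.2 ⟨hk, h⟩)⟩
  · rintro ⟨h1, h2⟩
    refine ⟨fun m hm => ?_, fun n hn hσ => ⟨h2 hn, fun m hm => ?_⟩⟩
    · rw [h1 m (mem_below.1 hm).1]
      exact (mem_below.1 hm).2
    · have : ¬ n < N := fun h => hσ (mem_below.2 ⟨h, h2 hn⟩)
      have := (mem_below.1 hm).1
      omega

theorem es_below_anti {b : IOI} {N M : ℕ} (h : N ≤ M) :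
    ES (below b M) (supp b) ⊆ ES (below b N) (supp b) := fun c hc => by
  rw [mem_es_below] at hc ⊢
  exact ⟨fun k hk => hc.1 k (hk.trans_le h), hc.2⟩

theorem self_mem_es_below (b : IOI) (N : ℕ) : b ∈ ES (below b N) (supp b) :=
  mem_es_below.2 ⟨fun _ _ => rfl, subset_rfl⟩

/-- An Ellentuck basic set contains a canonical neighbourhood of each of its points. -/
theorem es_below_subset {σ : Finset ℕ} {s : Set ℕ} {b : IOI} (hb : b ∈ ES σ s) {N : ℕ}
    (hN : ∀ m ∈ σ, m < N) : ES (below b N) (supp b) ⊆ ES σ s := fun c hc => by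
  rw [mem_es_below] at hc
  refine ⟨fun m hm => ?_, fun n hn hσ => hb.2 n (hc.2 hn) hσ⟩
  rw [hc.1 m (hN m hm)]
  exact hb.1 m hm

theorem mem_es_below_of_mem {σ : Finset ℕ} {s : Set ℕ} {b : IOI} (hb : b ∈ ES σ s) {N : ℕ}
    (hN : ∀ m ∈ σ, m < N) : b ∈ ES (below b N) s := by
  refine ⟨fun m hm => (mem_below.1 hm).2, fun n hn h => ⟨?_, fun m hm => ?_⟩⟩
  · refine (hb.2 n hn fun hσ => h (mem_below.2 ⟨hN n hσ, hn⟩)).1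
  · have : ¬ n < N := fun h' => h (mem_below.2 ⟨h', hn⟩)
    have := (mem_below.1 hm).1
    omega

theorem exists_bound (σ : Finset ℕ) : ∃ N, ∀ m ∈ σ, m < N :=
  ⟨σ.sup id + 1, fun _ hm => Nat.lt_succ_of_le (Finset.le_sup (f := id) hm)⟩

/-! ### Fusion and the Ellentuck theorem -/

theorem exists_subset_forall_finset {φ : Finset ℕ → Set ℕ → Prop}
    (mono : ∀ τ s t, t ⊆ s → φ τ s → φ τ t)
    (dense : ∀ τ s, s.Infinite → ∃ t ⊆ s, t.Infinite ∧ φ τ t)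
    (F : Finset (Finset ℕ)) {s : Set ℕ} (hs : s.Infinite) :
    ∃ t ⊆ s, t.Infinite ∧ ∀ τ ∈ F, φ τ t := by
  induction F using Finset.induction_on with
  | empty => exact ⟨s, subset_rfl, hs, by simp⟩
  | insert τ F _ ih =>
    obtain ⟨t, hts, ht, hF⟩ := ih
    obtain ⟨u, hut, hu, hτ⟩ := dense τ t ht
    refine ⟨u, hut.trans hts, hu, fun ρ hρ => ?_⟩
    rcases Finset.mem_insert.1 hρ with rfl | h
    · exact hτ
    · exact mono _ _ _ hut (hF ρ h)

theorem fusion {φ : Finset ℕ → Set ℕ → Prop}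
    (mono : ∀ τ s t, t ⊆ s → φ τ s → φ τ t)
    (loc : ∀ τ s, φ τ {n ∈ s | ∀ m ∈ τ, m < n} → φ τ s)
    (dense : ∀ τ s, s.Infinite → ∃ t ⊆ s, t.Infinite ∧ φ τ t)
    (N : ℕ) {s : Set ℕ} (hs : s.Infinite) :
    ∃ t ⊆ s, t.Infinite ∧ ∀ τ : Finset ℕ, (∀ m ∈ τ, m < N ∨ m ∈ t) → φ τ t := by
  obtain ⟨t₀, ht₀s, ht₀, h₀⟩ :=
    exists_subset_forall_finset mono dense (Finset.range N).powerset hs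
  have step : ∀ t : {t : Set ℕ // t.Infinite}, ∃ (n : ℕ) (u : {t : Set ℕ // t.Infinite}),
      n ∈ t.1 ∧ u.1 ⊆ t.1 ∧ (∀ m ∈ u.1, n < m) ∧
        ∀ τ ∈ (Finset.range (n + 1)).powerset, φ τ u.1 := by
    intro t
    obtain ⟨n, hn⟩ := t.2.nonempty
    obtain ⟨u, hut, hu, h⟩ := exists_subset_forall_finset mono dense
      (Finset.range (n + 1)).powerset (t.2.sdiff (Set.finite_Iic n))
    exact ⟨n, ⟨u, hu⟩, hn, fun m hm => (hut hm).1, fun m hm => not_le.1 (hut hm).2, h⟩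
  choose p nxt hp hsub hlt hφ using step
  let T : ℕ → {t : Set ℕ // t.Infinite} := fun i => nxt^[i] ⟨t₀, ht₀⟩
  have hT : ∀ i, T (i + 1) = nxt (T i) := fun i => Function.iterate_succ_apply' _ _ _
  have hanti : Antitone fun i => (T i).1 :=
    antitone_nat_of_succ_le fun i => by
      rw [hT]
      exact hsub _
  have hmono : StrictMono fun i => p (T i) :=
    strictMono_nat_of_lt_succ fun i => by
      refine hlt (T i) _ ?_
      rw [← hT]
      exact hp _
  have hmem : ∀ i, p (T i) ∈ t₀ := fun i => hanti (Nat.zero_le i) (hp _)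
  refine ⟨Set.range fun i => p (T i), ?_, Set.infinite_range_of_injective hmono.injective, ?_⟩
  · rintro _ ⟨i, rfl⟩
    exact ht₀s (hmem i)
  · intro τ hτ
    by_cases hN : ∀ m ∈ τ, m < N
    · refine mono _ t₀ _ ?_ (h₀ τ ?_)
      · rintro _ ⟨i, rfl⟩
        exact hmem i
      · exact Finset.mem_powerset.2 fun m hm => Finset.mem_range.2 (hN m hm)
    · push Not at hN
      obtain ⟨m, hm, hNm⟩ := hN
      have hne : τ.Nonempty := ⟨m, hm⟩
      have hmax : τ.max' hne ∈ τ := τ.max'_mem hne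
      have hmle : m ≤ τ.max' hne := τ.le_max' m hm
      obtain ⟨i, hi⟩ := (hτ _ hmax).resolve_left (by omega)
      simp only at hi
      apply loc
      refine mono _ (T (i + 1)).1 _ ?_ ?_
      · rintro _ ⟨⟨j, rfl⟩, hj⟩
        have := hj _ hmax
        rw [← hi] at this
        exact hanti (Nat.succ_le_of_lt (hmono.lt_iff_lt.1 this)) (hp _)
      · rw [hT]
        refine hφ _ _ (Finset.mem_powerset.2 fun k hk => ?_)
        rw [hi, Finset.mem_range]
        exact Nat.lt_succ_of_le (τ.le_max' k hk)

/-- Openness in the Ellentuck topology. -/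
def EllentuckOpen (U : Set IOI) : Prop := ∀ b ∈ U, ∃ N, ES (below b N) (supp b) ⊆ U

/-- `s` rejects `σ` if no infinite subset of `s` accepts it, that is, no `[σ,t]` with `t ⊆ s`
infinite is contained in `U`. -/
def Rejects (U : Set IOI) (σ : Finset ℕ) (s : Set ℕ) : Prop :=
  ∀ t ⊆ s, t.Infinite → ¬ ES σ t ⊆ U

theorem Rejects.mono {U : Set IOI} {σ : Finset ℕ} {s t : Set ℕ} (h : Rejects U σ s)
    (hts : t ⊆ s) : Rejects U σ t := fun u hu => h u (hu.trans hts)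

theorem rejects_of_sep {U : Set IOI} {σ τ : Finset ℕ} (hτ : τ ⊆ σ) {s : Set ℕ}
    (h : Rejects U σ {n ∈ s | ∀ m ∈ τ, m < n}) : Rejects U σ s := fun t hts ht hU =>
  h {n ∈ t | ∀ m ∈ σ, m < n} (fun _ hn => ⟨hts hn.1, fun m hm => hn.2 m (hτ hm)⟩)
    (infinite_sep_above σ ht) (by rwa [es_sep])

theorem exists_insert_mem_es {τ : Finset ℕ} {s : Set ℕ} {c : IOI} (hc : c ∈ ES τ s) :
    ∃ n ∈ s, (∀ m ∈ τ, m < n) ∧ c ∈ ES (insert n τ) s := by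
  classical
  have hex : ∃ n, n ∈ supp c ∧ n ∉ τ :=
    ((supp_infinite c).sdiff τ.finite_toSet).nonempty
  have hn := Nat.find_spec hex
  have hmin := fun m => Nat.find_min' (m := m) hex
  generalize Nat.find hex = n at hn hmin
  refine ⟨n, (hc.2 n hn.1 hn.2).1, (hc.2 n hn.1 hn.2).2, ?_, ?_⟩
  · intro m hm
    rcases Finset.mem_insert.1 hm with rfl | h
    · exact hn.1
    · exact hc.1 m h
  · intro k hk hkτ
    rw [Finset.mem_insert, not_or] at hkτ
    refine ⟨(hc.2 k hk hkτ.2).1, fun m hm => ?_⟩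
    rcases Finset.mem_insert.1 hm with rfl | h
    · exact lt_of_le_of_ne (hmin k ⟨hk, hkτ.2⟩) (Ne.symm hkτ.1)
    · exact (hc.2 k hk hkτ.2).2 m h

theorem exists_rejects_insert {U : Set IOI} {τ : Finset ℕ} {s : Set ℕ} (hs : s.Infinite)
    (hrej : Rejects U τ s) : ∃ t ⊆ s, t.Infinite ∧
      ∀ n ∈ t, (∀ m ∈ τ, m < n) → Rejects U (insert n τ) t := by
  classical
  obtain ⟨N, hN⟩ := exists_bound τ
  obtain ⟨t, hts, ht, hdec⟩ := fusion (φ := fun σ s => ES σ s ⊆ U ∨ Rejects U σ s)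
    (fun σ s t hts h => h.imp (es_mono hts).trans fun h => h.mono hts)
    (fun σ s h => h.imp (fun h => by rwa [es_sep] at h) (rejects_of_sep subset_rfl))
    (fun σ s hs => by
      by_cases h : Rejects U σ s
      · exact ⟨s, subset_rfl, hs, Or.inr h⟩
      · unfold Rejects at h
        push Not at h
        obtain ⟨t, hts, ht, h⟩ := h
        exact ⟨t, hts, ht, Or.inl h⟩) N hs
  have hfin : {n ∈ t | (∀ m ∈ τ, m < n) ∧ ES (insert n τ) t ⊆ U}.Finite := by
    by_contra hinf
    refine hrej _ ((Set.sep_subset _ _).trans hts) hinf fun c hc => ?_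
    obtain ⟨n, hn, -, hcn⟩ := exists_insert_mem_es hc
    exact hn.2.2 (es_mono (Set.sep_subset _ _) hcn)
  refine ⟨t \ {n ∈ t | (∀ m ∈ τ, m < n) ∧ ES (insert n τ) t ⊆ U},
    Set.sdiff_subset.trans hts, ht.sdiff hfin, fun n hn hτn => ?_⟩
  refine Rejects.mono ((hdec (insert n τ) fun m hm => ?_).resolve_left fun h => ?_)
    Set.sdiff_subset
  · rcases Finset.mem_insert.1 hm with rfl | h
    · exact Or.inr hn.1
    · exact Or.inl (hN m h)
  · exact hn.2 ⟨hn.1, hτn, h⟩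

/-- Sets open in the Ellentuck topology are completely Ramsey. -/
theorem EllentuckOpen.ramsey {U : Set IOI} (hU : EllentuckOpen U) (σ : Finset ℕ) {s : Set ℕ}
    (hs : s.Infinite) : ∃ t ⊆ s, t.Infinite ∧ (ES σ t ⊆ U ∨ Disjoint (ES σ t) U) := by
  classical
  obtain ⟨N, hN⟩ := exists_bound σ
  obtain ⟨t, hts, ht, hdec⟩ := fusion
    (φ := fun τ s => ES τ s ⊆ U ∨
      (Rejects U τ s ∧ ∀ n ∈ s, (∀ m ∈ τ, m < n) → Rejects U (insert n τ) s))
    (fun τ s t hts h => h.imp (es_mono hts).trans fun h =>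
      ⟨h.1.mono hts, fun n hn hτ => (h.2 n (hts hn) hτ).mono hts⟩)
    (fun τ s h => h.imp (fun h => by rwa [es_sep] at h) fun h =>
      ⟨rejects_of_sep subset_rfl h.1, fun n hn hτ =>
        rejects_of_sep (Finset.subset_insert _ _) (h.2 n ⟨hn, hτ⟩ hτ)⟩)
    (fun τ s hs => by
      by_cases h : Rejects U τ s
      · obtain ⟨t, hts, ht, h'⟩ := exists_rejects_insert hs h
        exact ⟨t, hts, ht, Or.inr ⟨h.mono hts, h'⟩⟩
      · unfold Rejects at h
        push Not at h
        obtain ⟨t, hts, ht, h⟩ := h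
        exact ⟨t, hts, ht, Or.inl h⟩) N hs
  refine ⟨t, hts, ht, or_iff_not_imp_left.2 fun hacc => ?_⟩
  have hσ : Rejects U σ t :=
    ((hdec σ fun m hm => Or.inl (hN m hm)).resolve_left hacc).1
  rw [Set.disjoint_left]
  intro b hb hbU
  have hσt : ∀ m ∈ supp b, m ∈ σ ∨ m ∈ t := fun m hm =>
    or_iff_not_imp_left.2 fun h => (hb.2 m hm h).1
  have hrej : ∀ M, Rejects U (σ ∪ below b M) t := by
    intro M
    induction M with
    | zero => simpa [below] using hσ
    | succ M ih =>
      by_cases hM : M ∈ supp b ∧ M ∉ σ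
      · have hins : σ ∪ below b (M + 1) = insert M (σ ∪ below b M) := by
          ext m
          simp only [Finset.mem_union, Finset.mem_insert, mem_below, Nat.lt_succ_iff_lt_or_eq]
          constructor
          · rintro (h | ⟨h | h, h'⟩) <;> tauto
          · rintro (rfl | h | h) <;> tauto
        rw [hins]
        refine ((hdec (σ ∪ below b M) fun m hm => ?_).resolve_left (ih t subset_rfl ht)).2 M
          (hb.2 M hM.1 hM.2).1 fun m hm => ?_
        · rcases Finset.mem_union.1 hm with h | h
          · exact Or.inl (hN m h)
          · exact (hσt m (mem_below.1 h).2).imp_left (hN m)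
        · rcases Finset.mem_union.1 hm with h | h
          · exact (hb.2 M hM.1 hM.2).2 m h
          · exact (mem_below.1 h).1
      · have heq : σ ∪ below b (M + 1) = σ ∪ below b M := by
          ext m
          simp only [Finset.mem_union, mem_below, Nat.lt_succ_iff_lt_or_eq]
          constructor
          · rintro (h | ⟨h | rfl, h'⟩) <;> tauto
          · tauto
        rwa [heq]
  obtain ⟨M, hM⟩ := hU b hbU
  have hM' := (es_below_anti (le_max_left M N)).trans hM
  have heq : σ ∪ below b (max M N) = below b (max M N) :=
    Finset.union_eq_right.2 fun m hm =>
      mem_below.2 ⟨(hN m hm).trans_le (le_max_right _ _), hb.1 m hm⟩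
  have := hrej (max M N)
  rw [heq] at this
  exact this (supp b \ σ) (fun m hm => (hσt m hm.1).resolve_left hm.2)
    ((supp_infinite b).sdiff σ.finite_toSet) ((es_mono Set.sdiff_subset).trans hM')

theorem ellentuckOpen_of_isOpen {U : Set IOI} (hU : IsOpen U) : EllentuckOpen U := by
  intro b hb
  obtain ⟨V, hV, rfl⟩ := isOpen_induced_iff.1 hU
  obtain ⟨N, hN⟩ := exists_cylinder_subset hV hb
  exact ⟨N, fun c hc => hN fun k hk => (mem_es_below.1 hc).1 k hk⟩

theorem isClosed_es (σ : Finset ℕ) (s : Set ℕ) : IsClosed (ES σ s) := by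
  have hc : ∀ n, Continuous fun a : IOI => a.1 n := fun n =>
    (continuous_apply n).comp continuous_subtype_val
  have : ES σ s = (⋂ m ∈ σ, {a | a.1 m = true}) ∩
      ⋂ n, {a : IOI | a.1 n ∈ {v : Bool | v = true → n ∉ σ → n ∈ s ∧ ∀ m ∈ σ, m < n}} := by
    ext a
    simp [ES]
  rw [this]
  refine IsClosed.inter (isClosed_biInter fun m _ => ?_) (isClosed_iInter fun n => ?_)
  · exact isClosed_eq (hc m) continuous_const
  · exact (isClosed_discrete _).preimage (hc n)

/-- A countable union of closed sets, each avoidable in every Ellentuck basic set, is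
avoidable. -/
theorem exists_disjoint_iUnion {D : ℕ → Set IOI}
    (hD : ∀ n (τ : Finset ℕ) (s : Set ℕ), s.Infinite →
      ∃ t ⊆ s, t.Infinite ∧ Disjoint (ES τ t) (D n))
    (σ : Finset ℕ) {s : Set ℕ} (hs : s.Infinite) :
    ∃ t ⊆ s, t.Infinite ∧ Disjoint (ES σ t) (⋃ n, D n) := by
  have dense : ∀ (k : ℕ) (τ : Finset ℕ) (s : Set ℕ), s.Infinite →
      ∃ t ⊆ s, t.Infinite ∧ ∀ n < k, Disjoint (ES τ t) (D n) := by
    intro k τ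
    induction k with
    | zero => exact fun s hs => ⟨s, subset_rfl, hs, by simp⟩
    | succ k ih =>
      intro s hs
      obtain ⟨t, hts, ht, h⟩ := ih s hs
      obtain ⟨u, hut, hu, h'⟩ := hD k τ t ht
      refine ⟨u, hut.trans hts, hu, fun n hn => ?_⟩
      rcases Nat.lt_succ_iff_lt_or_eq.1 hn with hn | rfl
      · exact (h n hn).mono_left (es_mono hut)
      · exact h'
  obtain ⟨N, hN⟩ := exists_bound σ
  obtain ⟨t, hts, ht, hφ⟩ := fusion
    (φ := fun τ s => ∀ n < τ.card, Disjoint (ES τ s) (D n))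
    (fun τ s t hts h n hn => (h n hn).mono_left (es_mono hts))
    (fun τ s h => by simpa only [es_sep] using h)
    (fun τ s hs => dense _ τ s hs) N hs
  refine ⟨t, hts, ht, Set.disjoint_iUnion_right.2 fun n => Set.disjoint_left.2 fun b hb => ?_⟩
  obtain ⟨F, hF, hFc⟩ := (supp_infinite b).exists_subset_card_eq (n + 1)
  obtain ⟨M, hM⟩ := exists_bound F
  have hMσ : ∀ m ∈ σ, m < max M N := fun m hm => (hN m hm).trans_le (le_max_right _ _)
  refine Set.disjoint_left.1 (hφ (below b (max M N)) (fun m hm => ?_) n ?_)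
    (mem_es_below_of_mem hb hMσ)
  · by_cases hmσ : m ∈ σ
    · exact Or.inl (hN m hmσ)
    · exact Or.inr (hb.2 m (mem_below.1 hm).2 hmσ).1
  · refine Nat.lt_of_succ_le (hFc.symm.le.trans (Finset.card_le_card fun m hm => ?_))
    exact mem_below.2 ⟨(hM m hm).trans_le (le_max_left _ _), hF hm⟩

/-- A Ramsey positive `G_δ` set contains an Ellentuck basic set. -/
theorem exists_es_subset_compl_iUnion {C : ℕ → Set IOI} (hC : ∀ n, IsClosed (C n))
    (h : RamseyPositive (⋃ n, C n)ᶜ) :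
    ∃ (σ : Finset ℕ) (s : Set ℕ), s.Infinite ∧ ES σ s ⊆ (⋃ n, C n)ᶜ := by
  by_contra! hno
  refine h fun σ s hs => ?_
  have hU : EllentuckOpen {b | ∃ N, ES (below b N) (supp b) ⊆ ⋃ n, C n} := by
    rintro b ⟨N, hN⟩
    refine ⟨N, fun c hc => ⟨N, (es_below_subset hc ?_).trans hN⟩⟩
    exact fun m hm => (mem_below.1 hm).1
  obtain ⟨t, hts, ht, hsub | hdisj⟩ := hU.ramsey σ hs.1
  · refine ⟨t, hts, ht, fun m hm n hn => hs.2 m hm n (hts hn), ?_⟩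
    rw [← Set.disjoint_iff_inter_eq_empty, Set.disjoint_compl_right_iff_subset]
    intro b hb
    obtain ⟨N, hN⟩ := hsub hb
    exact hN (self_mem_es_below b N)
  · obtain ⟨u, hut, hu, hd⟩ := exists_disjoint_iUnion (D := fun n => C n ∩ ES σ t) (fun n τ v hv => by
      obtain ⟨w, hwv, hw, h1 | h1⟩ := (ellentuckOpen_of_isOpen
        ((hC n).inter (isClosed_es σ t)).isOpen_compl).ramsey τ hv
      · exact ⟨w, hwv, hw, Set.disjoint_left.2 h1⟩
      · rw [Set.disjoint_compl_right_iff_subset] at h1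
        obtain ⟨b, hb⟩ := es_nonempty τ hw
        obtain ⟨N, hN⟩ := exists_bound τ
        refine absurd ?_ (Set.disjoint_left.1 hdisj (h1 hb).2)
        exact ⟨N, (es_below_subset hb hN).trans
          (h1.trans (Set.inter_subset_left.trans (Set.subset_iUnion C n)))⟩) σ ht
    refine absurd (fun b hb hbC => ?_) (hno σ u hu)
    obtain ⟨n, hn⟩ := Set.mem_iUnion.1 hbC
    exact Set.disjoint_left.1 hd hb (Set.mem_iUnion.2 ⟨n, hn, es_mono hut hb⟩)

theorem ramseyPositive_of_es_subset {A : Set IOI} {σ : Finset ℕ} {s : Set ℕ} (hs : s.Infinite)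
    (h : ES σ s ⊆ A) : RamseyPositive A := fun hA => by
  obtain ⟨t, hts, ht, -, he⟩ := hA σ {n ∈ s | ∀ m ∈ σ, m < n}
    ⟨infinite_sep_above σ hs, fun m hm n hn => hn.2 m hm⟩
  obtain ⟨b, hb⟩ := es_nonempty σ ht
  rw [← Set.disjoint_iff_inter_eq_empty] at he
  exact Set.disjoint_left.1 he hb (h (es_mono (hts.trans (Set.sep_subset _ _)) hb))

/-! ### Trees of sets -/

/-- The point `ℕ` of `[ω]^ω`. -/
def full : IOI := ⟨fun _ => true, by simpa using Set.infinite_univ⟩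

/-- The tree of finite initial segments of the elements of `D` and of `ℕ`. -/
noncomputable def treeOf (D : Set IOI) (l : List ℕ) : Bool :=
  open Classical in decide (∃ a ∈ insert full D, ∃ k, enumList a k = l)

theorem treeOf_eq_true {D : Set IOI} {l : List ℕ} :
    treeOf D l = true ↔ ∃ a ∈ insert full D, ∃ k, enumList a k = l := by
  simp [treeOf]

theorem enumList_succ (a : IOI) (k : ℕ) :
    enumList a (k + 1) = enumList a k ++ [Nat.nth (fun n => a.1 n = true) k] := by
  simp [enumList, List.range_succ]

theorem length_enumList (a : IOI) (k : ℕ) : (enumList a k).length = k := by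
  simp [enumList]

theorem isChain_enumList (a : IOI) (k : ℕ) : List.IsChain (· < ·) (enumList a k) := by
  rw [List.isChain_iff_pairwise]
  exact List.Pairwise.map _ (fun _ _ h => Nat.nth_strictMono a.2 h) List.pairwise_lt_range

theorem prunedIncTree_treeOf (D : Set IOI) : PrunedIncTree (treeOf D) := by
  refine ⟨?_, fun l hl => ?_, fun l n hl => ?_, fun l hl => ?_⟩
  · exact treeOf_eq_true.2 ⟨full, Set.mem_insert _ _, 0, rfl⟩
  · obtain ⟨a, -, k, rfl⟩ := treeOf_eq_true.1 hl
    exact isChain_enumList a k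
  · obtain ⟨a, ha, k, hk⟩ := treeOf_eq_true.1 hl
    cases k with
    | zero => simp [enumList] at hk
    | succ k =>
      rw [enumList_succ] at hk
      exact treeOf_eq_true.2 ⟨a, ha, k, (List.append_inj_left' hk rfl)⟩
  · obtain ⟨a, ha, k, rfl⟩ := treeOf_eq_true.1 hl
    exact ⟨_, treeOf_eq_true.2 ⟨a, ha, k + 1, enumList_succ a k⟩⟩

theorem apply_of_enumList_eq {a b : IOI} {k : ℕ} (h : enumList a k = enumList b k) {n : ℕ}
    (hn : n < k) (ha : a.1 n = true) : b.1 n = true := by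
  have hc := Nat.nth_count (p := fun n => a.1 n = true) ha
  have hlt : Nat.count (fun n => a.1 n = true) n < k := (Nat.count_le _).trans_lt hn
  have := List.map_inj_left.1 h _ (List.mem_range.2 hlt)
  rw [← hc, this]
  exact Nat.nth_mem_of_infinite b.2 _

theorem treeClosedSet_treeOf {D : Set IOI} (hD : IsClosed D) :
    treeClosedSet (treeOf D) = insert full D := by
  have hD' : IsClosed (insert full D) := by
    rw [Set.insert_eq]
    exact isClosed_singleton.union hD
  refine Set.Subset.antisymm (fun a ha => ?_) fun a ha k => treeOf_eq_true.2 ⟨a, ha, k, rfl⟩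
  by_contra hna
  obtain ⟨V, hV, hVD⟩ := isOpen_induced_iff.1 hD'.isOpen_compl
  have haV : a.1 ∈ V := hVD.ge hna
  obtain ⟨N, hN⟩ := exists_cylinder_subset hV haV
  obtain ⟨b, hb, k, hk⟩ := treeOf_eq_true.1 (ha N)
  obtain rfl : k = N := by simpa [length_enumList] using congrArg List.length hk
  suffices b ∈ (insert full D)ᶜ from this hb
  rw [← hVD]
  refine hN fun n hn => ?_
  rw [Bool.eq_iff_iff]
  exact ⟨apply_of_enumList_eq hk hn, apply_of_enumList_eq hk.symm hn⟩

/-- The code of the complement of the union of the sets `D n ∪ {ℕ}`. -/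
noncomputable def codeOf (D : ℕ → Set IOI) : GdCode :=
  ⟨fun n => treeOf (D n), fun n => prunedIncTree_treeOf (D n)⟩

theorem mem_gdelta_codeOf {D : ℕ → Set IOI} (hD : ∀ n, IsClosed (D n)) {a : IOI} :
    a ∈ Gdelta (codeOf D) ↔ a ≠ full ∧ ∀ n, a ∉ D n := by
  simp [Gdelta, codeOf, treeClosedSet_treeOf (hD _), forall_and]

/-! ### Codes -/

theorem enumList_count (a : IOI) (N : ℕ) :
    enumList a (Nat.count (fun n => a.1 n = true) N) = (List.range N).filter a.1 := by
  induction N with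
  | zero => simp [enumList]
  | succ N ih =>
    rw [Nat.count_succ, List.range_succ, List.filter_append, ← ih]
    by_cases h : a.1 N = true
    · have := Nat.nth_count (p := fun n => a.1 n = true) h
      simp [h, enumList, List.range_succ, this]
    · simp [h]

theorem mem_treeClosedSet_iff {T : List ℕ → Bool} {a : IOI} :
    a ∈ treeClosedSet T ↔ ∀ N, T ((List.range N).filter a.1) = true := by
  constructor
  · intro h N
    rw [← enumList_count]
    exact h _
  · intro h k
    have := h (Nat.nth (fun n => a.1 n = true) k)
    rwa [← enumList_count, Nat.count_nth_of_infinite a.2] at this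

theorem filter_range_congr {a b : ℕ → Bool} {N : ℕ} (h : ∀ k < N, a k = b k) :
    (List.range N).filter a = (List.range N).filter b :=
  List.filter_congr fun k hk => h k (List.mem_range.1 hk)

theorem isClosed_treeClosedSet (T : List ℕ → Bool) : IsClosed (treeClosedSet T) := by
  have : treeClosedSet T =
      ⋂ N, Subtype.val ⁻¹' {a : ℕ → Bool | T ((List.range N).filter a) = true} := by
    ext a
    simp [mem_treeClosedSet_iff]
  rw [this]
  refine isClosed_iInter fun N => IsClosed.preimage continuous_subtype_val ⟨?_⟩
  refine isOpen_of_cylinder fun x hx => ⟨N, fun y hy => ?_⟩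
  simp only [Set.mem_compl_iff, Set.mem_ofPred_eq] at hx ⊢
  rwa [filter_range_congr hy]

theorem ramseyPositive_gdelta_iff (z : GdCode) : RamseyPositive (Gdelta z) ↔
    ∃ (b : IOI) (N : ℕ), ES (below b N) (supp b) ⊆ Gdelta z := by
  constructor
  · intro h
    obtain ⟨σ, s, hs, hsub⟩ :=
      exists_es_subset_compl_iUnion (fun n => isClosed_treeClosedSet (z.1 n)) h
    obtain ⟨b, hb⟩ := es_nonempty σ hs
    obtain ⟨N, hN⟩ := exists_bound σ
    exact ⟨b, N, (es_below_subset hb hN).trans hsub⟩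
  · rintro ⟨b, N, h⟩
    exact ramseyPositive_of_es_subset (supp_infinite b) h

theorem measurableSet_infinite : MeasurableSet {a : ℕ → Bool | {n | a n = true}.Infinite} := by
  simp only [Set.infinite_iff_exists_gt, Set.mem_ofPred_eq]
  refine measurableSet_setOfPred.2 (Measurable.forall fun N => Measurable.exists fun n => ?_)
  refine Measurable.and ?_ measurable_const
  exact measurableSet_setOfPred.1 (measurableSet_eq_fun (measurable_pi_apply n) measurable_const)

theorem measurableSet_prunedIncTree : MeasurableSet {T : List ℕ → Bool | PrunedIncTree T} := by
  have hm : ∀ l, Measurable fun T : List ℕ → Bool => T l = true := fun l =>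
    measurableSet_setOfPred.1 (measurableSet_eq_fun (measurable_pi_apply l) measurable_const)
  refine measurableSet_setOfPred.2 ?_
  unfold PrunedIncTree
  refine (hm _).and (Measurable.and ?_ (Measurable.and ?_ ?_))
  · exact Measurable.forall fun l => (hm l).imp measurable_const
  · exact Measurable.forall fun l => Measurable.forall fun n => (hm _).imp (hm _)
  · exact Measurable.forall fun l => (hm l).imp (Measurable.exists fun n => hm _)

/-- The graph of the relation: `a` lies in the `n`-th closed set of `z` and in the Ellentuck basic set given
by `b` and `N`. -/
def badSet : Set (((ℕ → List ℕ → Bool) × (ℕ → Bool) × ℕ) × (ℕ → Bool)) :=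
  {p | {n | p.2 n = true}.Infinite ∧
    ((∀ k, k < p.1.2.2 → p.2 k = p.1.2.1 k) ∧ ∀ k, p.2 k = true → p.1.2.1 k = true) ∧
    ∃ n, ∀ M, p.1.1 n ((List.range M).filter p.2) = true}

theorem measurableSet_badSet : MeasurableSet badSet := by
  have ha : ∀ k, Measurable fun p : ((ℕ → List ℕ → Bool) × (ℕ → Bool) × ℕ) × (ℕ → Bool) =>
    p.2 k := by fun_prop
  have hb : ∀ k, Measurable fun p : ((ℕ → List ℕ → Bool) × (ℕ → Bool) × ℕ) × (ℕ → Bool) =>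
    p.1.2.1 k := by fun_prop
  have hT : ∀ n l, Measurable fun p : ((ℕ → List ℕ → Bool) × (ℕ → Bool) × ℕ) × (ℕ → Bool) =>
    p.1.1 n l := by fun_prop
  have htrue : ∀ f : ((ℕ → List ℕ → Bool) × (ℕ → Bool) × ℕ) × (ℕ → Bool) → Bool, Measurable f →
      Measurable fun p => f p = true := fun f hf =>
    measurableSet_setOfPred.1 (hf (measurableSet_singleton true))
  refine measurableSet_setOfPred.2 (Measurable.and ?_ (Measurable.and (Measurable.and ?_ ?_) ?_))
  · exact measurableSet_setOfPred.1 (measurable_snd measurableSet_infinite)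
  · refine Measurable.forall fun k => Measurable.imp ?_ ?_
    · have : Measurable fun p : ((ℕ → List ℕ → Bool) × (ℕ → Bool) × ℕ) × (ℕ → Bool) =>
        p.1.2.2 := by fun_prop
      exact measurableSet_setOfPred.1 (this (MeasurableSet.of_discrete (s := Set.Ioi k)))
    · exact measurableSet_setOfPred.1 (measurableSet_eq_fun (ha k) (hb k))
  · exact Measurable.forall fun k => (htrue _ (ha k)).imp (htrue _ (hb k))
  · refine Measurable.exists fun n => Measurable.forall fun M => ?_
    have : (fun p : ((ℕ → List ℕ → Bool) × (ℕ → Bool) × ℕ) × (ℕ → Bool) =>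
        p.1.1 n ((List.range M).filter p.2) = true) =
        fun p => ∃ l, (List.range M).filter p.2 = l ∧ p.1.1 n l = true := by
      ext p
      simp
    rw [this]
    refine Measurable.exists fun l => Measurable.and ?_ (htrue _ (hT n l))
    have ho : IsOpen {a : ℕ → Bool | (List.range M).filter a = l} :=
      isOpen_of_cylinder fun x hx => ⟨M, fun y hy => (filter_range_congr hy).trans hx⟩
    exact measurableSet_setOfPred.1 (measurable_snd ho.measurableSet)

theorem sigma12_ramseyPositive : Sigma12 {z : GdCode | RamseyPositive (Gdelta z)} := by
  have : PolishSpace ((ℕ → List ℕ → Bool) × (ℕ → Bool) × ℕ) := {}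
  have : PolishSpace (((ℕ → List ℕ → Bool) × (ℕ → Bool) × ℕ) × (ℕ → Bool)) := {}
  have hS : MeasurableSet {w : (ℕ → List ℕ → Bool) × (ℕ → Bool) × ℕ |
      (∀ n, PrunedIncTree (w.1 n)) ∧ {n | w.2.1 n = true}.Infinite} := by
    refine measurableSet_setOfPred.2 (Measurable.and (Measurable.forall fun n => ?_) ?_)
    · exact (measurableSet_setOfPred.1 measurableSet_prunedIncTree).comp
        ((measurable_pi_apply n).comp measurable_fst)
    · exact measurableSet_setOfPred.1
        ((measurable_fst.comp measurable_snd) measurableSet_infinite)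
  have hA := hS.analyticSet
  rw [AnalyticSet] at hA
  rcases hA with hA | ⟨h, hh, hr⟩
  · refine absurd hA (Set.Nonempty.ne_empty ⟨((codeOf fun _ => ∅).1, full.1, 0), ?_⟩)
    exact ⟨(codeOf fun _ => ∅).2, full.2⟩
  have hmem : ∀ x, (∀ n, PrunedIncTree ((h x).1 n)) ∧ {n | (h x).2.1 n = true}.Infinite :=
    fun x => hr.le ⟨x, rfl⟩
  refine ⟨(h ⁻¹' (Prod.fst '' badSet))ᶜ, fun x => ⟨(h x).1, (hmem x).1⟩, ?_, ?_, ?_⟩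
  · rw [compl_compl]
    exact (measurableSet_badSet.analyticSet.image_of_continuous continuous_fst).preimage hh
  · exact (continuous_fst.comp hh).subtype_mk _
  · have key : ∀ (z : GdCode) (b : IOI) (N : ℕ),
        ES (below b N) (supp b) ⊆ Gdelta z ↔ (z.1, b.1, N) ∉ Prod.fst '' badSet := by
      intro z b N
      constructor
      · rintro hsub ⟨⟨w, a⟩, ⟨ha, hab, n, hn⟩, rfl⟩
        have := @hsub ⟨a, ha⟩ (mem_es_below.2 hab)
        exact this (Set.mem_iUnion.2 ⟨n, mem_treeClosedSet_iff.2 hn⟩)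
      · intro hnot a ha hmem
        obtain ⟨n, hn⟩ := Set.mem_iUnion.1 hmem
        exact hnot ⟨((z.1, b.1, N), a.1),
          ⟨a.2, mem_es_below.1 ha, n, mem_treeClosedSet_iff.1 hn⟩, rfl⟩
    ext z
    rw [Set.mem_ofPred_eq, ramseyPositive_gdelta_iff]
    constructor
    · rintro ⟨x, hx, rfl⟩
      exact ⟨⟨(h x).2.1, (hmem x).2⟩, (h x).2.2, (key _ _ _).2 hx⟩
    · rintro ⟨b, N, hsub⟩
      obtain ⟨x, hx⟩ : (z.1, b.1, N) ∈ Set.range h := by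
        rw [hr]
        exact ⟨z.2, b.2⟩
      refine ⟨x, ?_, ?_⟩
      · rw [Set.mem_compl_iff, Set.mem_preimage, hx]
        exact (key _ _ _).1 hsub
      · apply Subtype.ext
        simp [hx]


/-! ### Coding points of Baire space by chains of initial segments -/

/-- The finite sequence with code `n`. -/
def seqOf (n : ℕ) : List ℕ := Denumerable.ofNat (List ℕ) n

theorem seqOf_injective : Function.Injective seqOf := fun m n h => by
  simpa [seqOf] using congrArg Encodable.encode h

/-- The set of codes of finite initial segments of `x`. -/
def prefixes (x : ℕ → ℕ) : Set ℕ := {n | seqOf n = (List.range (seqOf n).length).map x}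

theorem mem_prefixes {x : ℕ → ℕ} {n : ℕ} :
    n ∈ prefixes x ↔ seqOf n = (List.range (seqOf n).length).map x := Iff.rfl

theorem prefixes_infinite (x : ℕ → ℕ) : (prefixes x).Infinite := by
  refine Set.infinite_of_injective_forall_mem
    (f := fun k => Encodable.encode ((List.range k).map x)) (fun k l h => ?_) fun k => ?_
  · simpa using congrArg List.length (Encodable.encode_injective h)
  · simp [mem_prefixes, seqOf]

theorem eq_of_mem_prefixes {x : ℕ → ℕ} {m n : ℕ} (hm : m ∈ prefixes x) (hn : n ∈ prefixes x)
    (h : (seqOf m).length = (seqOf n).length) : m = n := by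
  apply seqOf_injective
  rw [mem_prefixes.1 hm, mem_prefixes.1 hn, h]

theorem exists_length_gt {A : Set ℕ} (hA : A.Infinite)
    (hinj : ∀ m ∈ A, ∀ n ∈ A, (seqOf m).length = (seqOf n).length → m = n) (k : ℕ) :
    ∃ n ∈ A, k < (seqOf n).length := by
  by_contra! h
  obtain ⟨m, hm, n, hn, hne, heq⟩ := hA.exists_ne_map_eq_of_mapsTo
    (f := fun n => (seqOf n).length) (t := Set.Iic k) h (Set.finite_Iic k)
  exact hne (hinj m hm n hn heq)

theorem apply_eq_of_mem_prefixes {x : ℕ → ℕ} {n k : ℕ} (hn : n ∈ prefixes x)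
    (hk : k < (seqOf n).length) : x k = (seqOf n)[k] := by
  have := List.getElem_of_eq (mem_prefixes.1 hn) hk
  simpa using this.symm

theorem eq_of_subset_prefixes {A : Set ℕ} (hA : A.Infinite) {x y : ℕ → ℕ}
    (hx : A ⊆ prefixes x) (hy : A ⊆ prefixes y) : x = y := by
  funext k
  obtain ⟨n, hn, hk⟩ :=
    exists_length_gt hA (fun m hm n hn => eq_of_mem_prefixes (hx hm) (hx hn)) k
  rw [apply_eq_of_mem_prefixes (hx hn) hk, apply_eq_of_mem_prefixes (hy hn) hk]

theorem isClosed_setOf_mem_prefixes (n : ℕ) : IsClosed {x | n ∈ prefixes x} := by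
  refine ⟨isOpen_of_cylinder fun x hx => ⟨(seqOf n).length, fun y hy hny => hx ?_⟩⟩
  refine (mem_prefixes.1 hny).trans (List.map_congr_left fun k hk => ?_)
  exact hy k (List.mem_range.1 hk)

theorem eventually_mem_supp {a : IOI} {u : Filter IOI} (hu : u ≤ nhds a) {n : ℕ}
    (hn : n ∈ supp a) : ∀ᶠ b in u, n ∈ supp b := by
  have hc : Continuous fun a : IOI => a.1 n :=
    (continuous_apply n).comp continuous_subtype_val
  exact hu ((isOpen_discrete {true}).preimage hc |>.mem_nhds hn)

theorem supp_subset_prefixes_of_tendsto {a : IOI} {u : Filter IOI} [u.NeBot] (hu : u ≤ nhds a)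
    {X : IOI → ℕ → ℕ} (hX : ∀ᶠ b in u, supp b ⊆ prefixes (X b)) {x : ℕ → ℕ}
    (hx : Filter.Tendsto X u (nhds x)) : supp a ⊆ prefixes x := fun n hn =>
  (isClosed_setOf_mem_prefixes n).mem_of_tendsto hx <| by
    filter_upwards [hX, eventually_mem_supp hu hn] with b hb hnb using hb hnb

theorem isClosed_exists_subset_prefixes {V : Set (ℕ → ℕ)} (hV : IsClosed V) :
    IsClosed {a : IOI | ∃ x ∈ V, supp a ⊆ prefixes x} := by
  refine isClosed_iff_ultrafilter.2 fun a u hu hmem => ?_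
  have : ∀ b : IOI, ∃ x, b ∈ {a : IOI | ∃ x ∈ V, supp a ⊆ prefixes x} →
      x ∈ V ∧ supp b ⊆ prefixes x := fun b => by
    by_cases h : b ∈ {a : IOI | ∃ x ∈ V, supp a ⊆ prefixes x}
    · obtain ⟨x, hx⟩ := h
      exact ⟨x, fun _ => hx⟩
    · exact ⟨0, fun h' => absurd h' h⟩
  choose X hX using this
  have hXV : ∀ᶠ b in (u : Filter IOI), X b ∈ V ∧ supp b ⊆ prefixes (X b) :=
    Filter.mem_of_superset hmem hX
  have hinj : ∀ m ∈ supp a, ∀ n ∈ supp a, (seqOf m).length = (seqOf n).length → m = n := by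
    intro m hm n hn h
    obtain ⟨b, hb, hmb, hnb⟩ :=
      (hXV.and ((eventually_mem_supp hu hm).and (eventually_mem_supp hu hn))).exists
    exact eq_of_mem_prefixes (hb.2 hmb) (hb.2 hnb) h
  have hlim : ∀ k, ∃ c, ∀ᶠ b in (u : Filter IOI), X b k = c := by
    intro k
    obtain ⟨n, hn, hk⟩ := exists_length_gt (supp_infinite a) hinj k
    refine ⟨(seqOf n)[k], ?_⟩
    filter_upwards [hXV, eventually_mem_supp hu hn] with b hb hnb
      using apply_eq_of_mem_prefixes (hb.2 hnb) hk
  choose x hx using hlim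
  have htend : Filter.Tendsto X u (nhds x) :=
    tendsto_pi_nhds.2 fun k => tendsto_nhds_of_eventually_eq (hx k)
  exact ⟨x, hV.mem_of_tendsto htend (hXV.mono fun b hb => hb.1),
    supp_subset_prefixes_of_tendsto hu (hXV.mono fun b hb => hb.2) htend⟩

/-- The gaps of `a` dominate `y`, up to the additive constant `m`. -/
def Dominated (m : ℕ) (a : IOI) (y : ℕ → ℕ) : Prop :=
  ∀ n ∈ supp a, ∀ n' ∈ supp a, n < n' → ∀ k ≤ n, y k ≤ m + n'

theorem isClosed_exists_dominated {Y : Set (ℕ → ℕ)} (hY : IsClosed Y)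
    {g : (ℕ → ℕ) → ℕ → ℕ} (hg : Continuous g) (m : ℕ) :
    IsClosed {a : IOI | ∃ y ∈ Y, Dominated m a y ∧ supp a ⊆ prefixes (g y)} := by
  refine isClosed_iff_ultrafilter.2 fun a u hu hmem => ?_
  set D := {a : IOI | ∃ y ∈ Y, Dominated m a y ∧ supp a ⊆ prefixes (g y)}
  have : ∀ b : IOI, ∃ y, b ∈ D → y ∈ Y ∧ Dominated m b y ∧ supp b ⊆ prefixes (g y) :=
    fun b => by
      by_cases h : b ∈ D
      · obtain ⟨x, hx⟩ := h
        exact ⟨x, fun _ => hx⟩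
      · exact ⟨0, fun h' => absurd h' h⟩
  choose X hX using this
  have hXD : ∀ᶠ b in (u : Filter IOI),
      X b ∈ Y ∧ Dominated m b (X b) ∧ supp b ⊆ prefixes (g (X b)) :=
    Filter.mem_of_superset hmem hX
  have hdom : ∀ n ∈ supp a, ∀ n' ∈ supp a, n < n' → ∀ k ≤ n,
      ∀ᶠ b in (u : Filter IOI), X b k ≤ m + n' := by
    intro n hn n' hn' hlt k hk
    filter_upwards [hXD, eventually_mem_supp hu hn, eventually_mem_supp hu hn']
      with b hb hnb hnb' using hb.2.1 n hnb n' hnb' hlt k hk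
  have hlim : ∀ k, ∃ c, ∀ᶠ b in (u : Filter IOI), X b k = c := by
    intro k
    obtain ⟨n, hn, hkn⟩ := (supp_infinite a).exists_gt k
    obtain ⟨n', hn', hlt⟩ := (supp_infinite a).exists_gt n
    obtain ⟨c, -, hc⟩ := (Set.finite_Iic (m + n')).isCompact.ultrafilter_le_nhds
      (u.map fun b => X b k) (Filter.le_principal_iff.2 (hdom n hn n' hn' hlt k hkn.le))
    exact ⟨c, hc ((isOpen_discrete {c}).mem_nhds rfl)⟩
  choose y hy using hlim
  have htend : Filter.Tendsto X u (nhds y) :=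
    tendsto_pi_nhds.2 fun k => tendsto_nhds_of_eventually_eq (hy k)
  refine ⟨y, hY.mem_of_tendsto htend (hXD.mono fun b hb => hb.1), ?_,
    supp_subset_prefixes_of_tendsto hu (hXD.mono fun b hb => hb.2.2)
      ((hg.tendsto y).comp htend)⟩
  intro n hn n' hn' hlt k hk
  obtain ⟨b, hb, hb'⟩ := ((hdom n hn n' hn' hlt k hk).and (hy k)).exists
  exact hb' ▸ hb

theorem exists_sparse_subset {s : Set ℕ} (hs : s.Infinite) (y : ℕ → ℕ) :
    ∃ t ⊆ s, t.Infinite ∧ ∀ n ∈ t, ∀ n' ∈ t, n < n' → ∀ k ≤ n, y k ≤ n' := by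
  obtain ⟨f, hf, hr⟩ := exists_seq_of_forall_finset_exists (· ∈ s)
    (fun n n' => n < n' ∧ ∀ k ≤ n, y k ≤ n') (fun F _ => by
      obtain ⟨M, hM⟩ := exists_bound F
      obtain ⟨K, hK⟩ := exists_bound ((Finset.range M).image y)
      obtain ⟨n', hn', hlt⟩ := hs.exists_gt (max M K)
      have h1 := le_max_left M K
      have h2 := le_max_right M K
      refine ⟨n', hn', fun n hn => ⟨by have := hM n hn; omega, fun k hk => ?_⟩⟩
      have := hK (y k) (Finset.mem_image_of_mem y (Finset.mem_range.2 (hk.trans_lt (hM n hn))))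
      omega)
  have hmono : StrictMono f := fun i j h => (hr i j h).1
  refine ⟨Set.range f, Set.range_subset_iff.2 hf,
    Set.infinite_range_of_injective hmono.injective, ?_⟩
  rintro _ ⟨i, rfl⟩ _ ⟨j, rfl⟩ h
  exact (hr i j (hmono.lt_iff_lt.1 h)).2

theorem exists_dominated {σ : Finset ℕ} {t : Set ℕ} {y : ℕ → ℕ}
    (ht : ∀ n ∈ t, ∀ n' ∈ t, n < n' → ∀ k ≤ n, y k ≤ n') :
    ∃ m, ∀ b ∈ ES σ t, Dominated m b y := by
  obtain ⟨M, hM⟩ := exists_bound σ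
  obtain ⟨m, hm⟩ := exists_bound ((Finset.range M).image y)
  refine ⟨m, fun b hb n hn n' hn' hlt k hk => ?_⟩
  by_cases hkM : k < M
  · have := hm _ (Finset.mem_image_of_mem y (Finset.mem_range.2 hkM))
    omega
  · have h : ∀ i ∈ supp b, M ≤ i → i ∈ t := fun i hi hMi =>
      (hb.2 i hi fun hiσ => absurd (hM i hiσ) (by omega)).1
    have := ht n (h n hn (by omega)) n' (h n' hn' (by omega)) hlt k hk
    omega

/-! ### Hardness -/

theorem exists_continuous_image_eq {S : Set (ℕ → ℕ)} (hS : AnalyticSet S) :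
    ∃ (Y : Set (ℕ → ℕ)) (g : (ℕ → ℕ) → ℕ → ℕ), IsClosed Y ∧ Continuous g ∧ g '' Y = S := by
  rw [AnalyticSet] at hS
  rcases hS with rfl | ⟨g, hg, rfl⟩
  · exact ⟨∅, id, isClosed_empty, continuous_id, Set.image_empty _⟩
  · exact ⟨Set.univ, g, isClosed_univ, hg, Set.image_univ⟩

/-- Membership in a `Σ¹₂` set reduces to Ramsey positivity of a `G_δ` set whose closed
pieces depend on the parameter only through membership in open sets. -/
theorem exists_closed_family {Z : Type*} [TopologicalSpace Z] [SecondCountableTopology Z]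
    [T1Space Z] {B : Set Z} (hB : Sigma12 B) :
    ∃ (U : ℕ → Set Z) (D : ℕ → Set IOI), (∀ n, IsOpen (U n)) ∧ (∀ n, IsClosed (D n)) ∧
      ∀ z, RamseyPositive {a | a ≠ full ∧ ∀ n, z ∈ U n → a ∉ D n} ↔ z ∈ B := by
  obtain ⟨C, f, hC, hf, hfC⟩ := hB
  obtain ⟨Y, g, hY, hg, hgY⟩ := exists_continuous_image_eq hC
  obtain ⟨𝒰, h𝒰c, -, h𝒰⟩ := exists_countable_basis Z
  obtain ⟨F, hFc, -, hF, -⟩ : ∃ F : ℕ → Set IOI, (∀ n, IsClosed (F n)) ∧ (∀ n, F n ⊆ _) ∧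
      ⋃ n, F n = {a : IOI | ∃ x ∈ Set.univ, supp a ⊆ prefixes x}ᶜ ∧ Monotone F := by
    have : MetrizableSpace IOI := Topology.IsEmbedding.subtypeVal.metrizableSpace
    let := TopologicalSpace.metrizableSpaceMetric IOI
    exact (isClosed_exists_subset_prefixes isClosed_univ).isOpen_compl.exists_iUnion_isClosed
  have := h𝒰c.to_subtype
  let U : ℕ ⊕ 𝒰 ⊕ ℕ → Set Z := Sum.elim (fun _ => Set.univ) (Sum.elim Subtype.val fun _ => Set.univ)
  let D : ℕ ⊕ 𝒰 ⊕ ℕ → Set IOI := Sum.elim F (Sum.elim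
    (fun V => {a | ∃ x ∈ (f ⁻¹' V.1)ᶜ, supp a ⊆ prefixes x})
    fun m => {a | ∃ y ∈ Y, Dominated m a y ∧ supp a ⊆ prefixes (g y)})
  obtain ⟨e, he⟩ := exists_surjective_nat (ℕ ⊕ 𝒰 ⊕ ℕ)
  refine ⟨U ∘ e, D ∘ e, fun n => ?_, fun n => ?_, fun z => ?_⟩
  · rw [Function.comp_apply]
    rcases e n with m | V | m
    · exact isOpen_univ
    · exact h𝒰.isOpen V.2
    · exact isOpen_univ
  · rw [Function.comp_apply]
    rcases e n with m | V | m
    · exact hFc m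
    · exact isClosed_exists_subset_prefixes ((h𝒰.isOpen V.2).preimage hf).isClosed_compl
    · exact isClosed_exists_dominated hY hg m
  · have hset : {a | a ≠ full ∧ ∀ n, z ∈ (U ∘ e) n → a ∉ (D ∘ e) n} =
        {a | a ≠ full ∧ ∀ i, z ∈ U i → a ∉ D i} := by
      ext a
      simp only [Function.comp_apply, Set.mem_ofPred_eq, he.forall]
    rw [hset]
    constructor
    · contrapose!
      intro hz hpos
      refine hpos fun σ s hs => ?_
      by_cases hemp : ES σ s ∩ {a | a ≠ full ∧ ∀ i, z ∈ U i → a ∉ D i} = ∅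
      · exact ⟨s, subset_rfl, hs.1, hs.2, hemp⟩
      obtain ⟨a, haσ, -, ha⟩ := Set.nonempty_iff_ne_empty.2 hemp
      obtain ⟨x, -, hx⟩ : a ∈ {a : IOI | ∃ x ∈ Set.univ, supp a ⊆ prefixes x} := by
        by_contra hna
        obtain ⟨n, hn⟩ := Set.mem_iUnion.1 (hF.ge hna)
        exact ha (Sum.inl n) trivial hn
      have hfx : f x = z := by
        by_contra hne
        obtain ⟨V, hV, hzV, hVx⟩ := h𝒰.exists_subset_of_mem_open
          (show z ∈ ({f x} : Set Z)ᶜ from fun h => hne (Eq.symm h)) isClosed_singleton.isOpen_compl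
        exact ha (Sum.inr (Sum.inl ⟨V, hV⟩)) hzV ⟨x, fun h => hVx h rfl, hx⟩
      have hxC : x ∈ Cᶜ := fun h => hz (hfC ▸ ⟨x, h, hfx⟩)
      rw [← hgY] at hxC
      obtain ⟨y, hy, rfl⟩ := hxC
      obtain ⟨t, hta, ht, hsp⟩ := exists_sparse_subset ((supp_infinite a).sdiff σ.finite_toSet) y
      obtain ⟨m, hm⟩ := exists_dominated (σ := σ) hsp
      refine ⟨t, fun n hn => (haσ.2 n (hta hn).1 (hta hn).2).1, ht,
        fun i hi n hn => (haσ.2 n (hta hn).1 (hta hn).2).2 i hi, ?_⟩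
      rw [← Set.disjoint_iff_inter_eq_empty, Set.disjoint_left]
      rintro b hb ⟨-, hbD⟩
      refine hbD (Sum.inr (Sum.inr m)) trivial ⟨y, hy, hm b hb, fun n hn => hx ?_⟩
      by_cases hnσ : n ∈ σ
      · exact haσ.1 n hnσ
      · exact (hta (hb.2 n hn hnσ).1).1
    · intro hz
      rw [← hfC] at hz
      obtain ⟨x, hxC, rfl⟩ := hz
      obtain ⟨p, hp⟩ := (prefixes_infinite x).nonempty
      refine ramseyPositive_of_es_subset (σ := ∅) (s := prefixes x \ {p})
        ((prefixes_infinite x).sdiff (Set.finite_singleton p)) fun a ha => ?_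
      have hsub : supp a ⊆ prefixes x \ {p} := fun n hn => (ha.2 n hn (by simp)).1
      have hax : supp a ⊆ prefixes x := hsub.trans Set.sdiff_subset
      refine ⟨fun h => (hsub (show p ∈ supp a by rw [h]; rfl)).2 rfl, ?_⟩
      rintro (n | V | m) hzU haD
      · exact (hF.le (Set.mem_iUnion.2 ⟨n, haD⟩)) ⟨x, trivial, hax⟩
      · obtain ⟨x', hx', hax'⟩ := haD
        rw [eq_of_subset_prefixes (supp_infinite a) hax' hax] at hx'
        exact hx' hzU
      · obtain ⟨y, hy, -, hay⟩ := haD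
        rw [eq_of_subset_prefixes (supp_infinite a) hax hay] at hxC
        exact hgY.le ⟨y, hy, rfl⟩ hxC

end RamseyCode

open RamseyCode

/-- The set of codes of Ramsey positive `G_δ` subsets of `[ω]^ω` is
`(Σ¹₂,Σ¹₁∪Π¹₁)`-complete with respect to the fixed subbase of `𝒞`. -/
theorem statement2 :
    SubComplete codeSubbase {z : GdCode | RamseyPositive (Gdelta z)} := by
  classical
  refine ⟨sigma12_ramseyPositive, fun Z _ _ _ B hB => ?_⟩
  obtain ⟨U, D, hU, hD, hred⟩ := exists_closed_family hB
  have hD' : ∀ (z : Z) (n : ℕ), IsClosed (if z ∈ U n then D n else ∅) := fun z n => by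
    split_ifs
    exacts [hD n, isClosed_empty]
  refine ⟨fun z => codeOf fun n => if z ∈ U n then D n else ∅, fun ⟨n, σ, v⟩ => Or.inl ?_, ?_⟩
  · let := borel Z
    have : BorelSpace Z := ⟨rfl⟩
    refine MeasurableSet.analyticSet ?_
    have : (fun z => codeOf fun n => if z ∈ U n then D n else ∅) ⁻¹' codeSubbase (n, σ, v) =
        Set.ite (U n) {_z | treeOf (D n) σ.1 = v} {_z | treeOf ∅ σ.1 = v} := by
      ext z
      by_cases hz : z ∈ U n <;> simp [codeSubbase, codeOf, Set.ite, hz]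
    rw [this]
    exact (hU n).measurableSet.ite (.const _) (.const _)
  · ext z
    rw [← hred z, Set.mem_preimage, Set.mem_ofPred_eq]
    have : Gdelta (codeOf fun n => if z ∈ U n then D n else ∅) =
        {a | a ≠ full ∧ ∀ n, z ∈ U n → a ∉ D n} := by
      ext a
      rw [mem_gdelta_codeOf (hD' z)]
      refine and_congr_right fun _ => forall_congr' fun n => ?_
      by_cases hz : z ∈ U n <;> simp [hz]
    rw [this]
end

section
/- A closed set C ⊆ [ω]^ω is Ramsey positive if and only if there exist a finite set σ ⊆ ℕ and an infinite set s ⊆ ℕ with max σ < min s such that [σ,s] ⊆ C. -/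
open MeasureTheory TopologicalSpace

/-- `AboveSubset τ Y X`: every element of `Y` lying above all of `τ` belongs to `X`. -/
def AboveSubset (τ : Finset ℕ) (Y X : Set ℕ) : Prop :=
  ∀ n ∈ Y, (∀ m ∈ τ, m < n) → n ∈ X

theorem infinite_above {X : Set ℕ} (hX : X.Infinite) (τ : Finset ℕ) :
    {n ∈ X | ∀ m ∈ τ, m < n}.Infinite := by
  refine (hX.sdiff (Set.finite_Iic (τ.sup id))).mono ?_
  rintro n ⟨hn, hτ⟩
  refine ⟨hn, fun m hm => ?_⟩
  have : m ≤ τ.sup id := Finset.le_sup (f := id) hm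
  simp only [Set.mem_Iic, not_le] at hτ
  omega

theorem ES_subset_of_aboveSubset {τ : Finset ℕ} {Y X : Set ℕ} (h : AboveSubset τ Y X) :
    ES τ Y ⊆ ES τ X := fun _ ha =>
  ⟨ha.1, fun n hn hτ => ⟨h n (ha.2 n hn hτ).1 (ha.2 n hn hτ).2, (ha.2 n hn hτ).2⟩⟩

theorem ES_nonempty (σ : Finset ℕ) {s : Set ℕ} (hs : s.Infinite) : (ES σ s).Nonempty := by
  classical
  have hinf := infinite_above hs σ
  refine ⟨⟨fun n => decide (n ∈ σ ∨ n ∈ {n ∈ s | ∀ m ∈ σ, m < n}), ?_⟩, ?_, ?_⟩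
  · refine hinf.mono fun n hn => ?_
    simpa using Or.inr hn
  · intro m hm
    simp [hm]
  · intro n hn hσ
    simpa [hσ] using hn

section Fusion

variable {P : Finset ℕ → Set ℕ → Prop}

theorem exists_subset_forall_mem
    (hmono : ∀ τ X Y, AboveSubset τ Y X → P τ X → P τ Y)
    (hdense : ∀ τ (X : Set ℕ), X.Infinite → ∃ Y ⊆ X, Y.Infinite ∧ P τ Y)
    (F : Finset (Finset ℕ)) {X : Set ℕ} (hX : X.Infinite) :
    ∃ Y ⊆ X, Y.Infinite ∧ ∀ τ ∈ F, P τ Y := by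
  classical
  induction F using Finset.induction_on with
  | empty => exact ⟨X, subset_rfl, hX, by simp⟩
  | insert τ F _ ih =>
    obtain ⟨Y, hYX, hY, hF⟩ := ih
    obtain ⟨Z, hZY, hZ, hτ⟩ := hdense τ Y hY
    refine ⟨Z, hZY.trans hYX, hZ, fun ρ hρ => ?_⟩
    rcases Finset.mem_insert.1 hρ with rfl | hρ
    · exact hτ
    · exact hmono ρ Y Z (fun n hn _ => hZY hn) (hF ρ hρ)

/-- The fusion lemma: a hereditary, dense property that only depends on the elements above `τ`
can be achieved simultaneously for all finite `τ` whose maximum lies in the limit set. -/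
theorem exists_fusion_s4
    (hmono : ∀ τ X Y, AboveSubset τ Y X → P τ X → P τ Y)
    (hdense : ∀ τ (X : Set ℕ), X.Infinite → ∃ Y ⊆ X, Y.Infinite ∧ P τ Y)
    {X : Set ℕ} (hX : X.Infinite) :
    ∃ Y ⊆ X, Y.Infinite ∧ ∀ (τ : Finset ℕ) (n : ℕ), n ∈ τ → n ∈ Y → (∀ m ∈ τ, m ≤ n) → P τ Y := by
  have step : ∀ S : {S : Set ℕ // S.Infinite}, ∃ T : {T : Set ℕ // T.Infinite}, T.1 ⊆ S.1 ∧
      (∀ k ∈ T.1, sInf S.1 < k) ∧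
      ∀ τ : Finset ℕ, (∀ m ∈ τ, m ≤ sInf S.1) → P τ T.1 := by
    rintro ⟨S, hS⟩
    obtain ⟨T, hTS, hT, hP⟩ := exists_subset_forall_mem hmono hdense
      (Finset.range (sInf S + 1)).powerset (infinite_above hS {sInf S})
    refine ⟨⟨T, hT⟩, fun n hn => (hTS hn).1, fun k hk => by simpa using (hTS hk).2,
      fun τ hτ => hP τ (Finset.mem_powerset.2 fun m hm => ?_)⟩
    exact Finset.mem_range.2 (Nat.lt_succ_of_le (hτ m hm))
  choose f hfsub hflt hfP using step
  let S : ℕ → {S : Set ℕ // S.Infinite} := fun k => f^[k] ⟨X, hX⟩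
  have hS : ∀ k, S (k + 1) = f (S k) := fun k => Function.iterate_succ_apply' f k _
  have hanti : Antitone fun k => (S k).1 :=
    antitone_nat_of_succ_le fun k => by rw [hS]; exact hfsub _
  have hmem : ∀ k, sInf (S k).1 ∈ (S k).1 := fun k => Nat.sInf_mem (S k).2.nonempty
  have hstrict : StrictMono fun k => sInf (S k).1 :=
    strictMono_nat_of_lt_succ fun k => hflt (S k) _ (hS k ▸ hmem (k + 1))
  refine ⟨Set.range fun k => sInf (S k).1, ?_, Set.infinite_range_of_injective hstrict.injective, ?_⟩
  · rintro _ ⟨k, rfl⟩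
    exact hanti (Nat.zero_le k) (hmem k)
  · rintro τ _ hτ ⟨k, rfl⟩ hle
    refine hmono τ (S (k + 1)).1 _ ?_ (hS k ▸ hfP (S k) τ hle)
    rintro _ ⟨j, rfl⟩ hj
    have hkj : k < j := hstrict.lt_iff_lt.1 (hj _ hτ)
    exact hanti hkj (hmem j)

end Fusion

/-- `X` rejects `τ` with respect to `U`: no infinite set which is contained in `X` above `τ`
has its Ellentuck set at `τ` inside `U`. -/
def Rejects (U : Set IOI) (X : Set ℕ) (τ : Finset ℕ) : Prop :=
  ∀ W : Set ℕ, W.Infinite → AboveSubset τ W X → ¬ ES τ W ⊆ U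

theorem Rejects.mono {U : Set IOI} {X Y : Set ℕ} {τ : Finset ℕ} (h : Rejects U X τ)
    (hYX : AboveSubset τ Y X) : Rejects U Y τ := fun W hW hWY =>
  h W hW fun n hn hτ => hYX n (hWY n hn hτ) hτ

theorem exists_subset_or_rejects (U : Set IOI) (τ : Finset ℕ) {X : Set ℕ} (hX : X.Infinite) :
    ∃ Y ⊆ X, Y.Infinite ∧ (ES τ Y ⊆ U ∨ Rejects U Y τ) := by
  by_cases h : Rejects U X τ
  · exact ⟨X, subset_rfl, hX, Or.inr h⟩
  · simp only [Rejects, not_forall, not_not] at h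
    obtain ⟨W, hW, hWX, hU⟩ := h
    exact ⟨{n ∈ W | ∀ m ∈ τ, m < n}, fun n hn => hWX n hn.1 hn.2, infinite_above hW τ,
      Or.inl ((ES_subset_of_aboveSubset fun n hn _ => hn.1).trans hU)⟩

theorem subset_or_rejects_mono (U : Set IOI) (τ : Finset ℕ) (X Y : Set ℕ)
    (hYX : AboveSubset τ Y X) (h : ES τ X ⊆ U ∨ Rejects U X τ) :
    ES τ Y ⊆ U ∨ Rejects U Y τ :=
  h.imp (ES_subset_of_aboveSubset hYX).trans fun h => h.mono hYX

theorem ES_subset_of_forall_insert {U : Set IOI} {τ : Finset ℕ} {Y Z : Set ℕ}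
    (hZY : Z ⊆ Y) (h : ∀ n ∈ Z, ES (insert n τ) Y ⊆ U) : ES τ Z ⊆ U := by
  intro a ha
  have hne : {n | a.1 n = true ∧ n ∉ τ}.Nonempty := (a.2.sdiff τ.finite_toSet).nonempty
  set k := sInf {n | a.1 n = true ∧ n ∉ τ}
  have hk : a.1 k = true ∧ k ∉ τ := Nat.sInf_mem hne
  refine h k (ha.2 k hk.1 hk.2).1 ⟨?_, fun n hn hnτ => ?_⟩
  · intro m hm
    rcases Finset.mem_insert.1 hm with rfl | hm
    exacts [hk.1, ha.1 m hm]
  · rw [Finset.mem_insert, not_or] at hnτ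
    have hn' := ha.2 n hn hnτ.2
    refine ⟨hZY hn'.1, fun m hm => ?_⟩
    rcases Finset.mem_insert.1 hm with rfl | hm
    · exact lt_of_le_of_ne (Nat.sInf_le ⟨hn, hnτ.2⟩) (Ne.symm hnτ.1)
    · exact hn'.2 m hm

theorem exists_subset_or_rejects_insert (U : Set IOI) (τ : Finset ℕ) {X : Set ℕ}
    (hX : X.Infinite) :
    ∃ Y ⊆ X, Y.Infinite ∧
      (ES τ Y ⊆ U ∨ ∀ n ∈ Y, (∀ m ∈ τ, m < n) → Rejects U Y (insert n τ)) := by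
  obtain ⟨S, hSX, hS, hacc | hrej⟩ := exists_subset_or_rejects U τ hX
  · exact ⟨S, hSX, hS, Or.inl hacc⟩
  obtain ⟨Y, hYS, hY, hdec⟩ := exists_fusion_s4 (subset_or_rejects_mono U)
    (fun τ _ => exists_subset_or_rejects U τ) (infinite_above hS τ)
  have hfin : {n ∈ Y | ES (insert n τ) Y ⊆ U}.Finite := by
    by_contra hinf
    exact hrej _ hinf (fun n hn _ => (hYS hn.1).1)
      (ES_subset_of_forall_insert (fun n hn => hn.1) fun n hn => hn.2)
  refine ⟨Y \ {n ∈ Y | ES (insert n τ) Y ⊆ U}, fun n hn => hSX (hYS hn.1).1, hY.sdiff hfin,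
    Or.inr fun n hn hτ => ?_⟩
  have hle : ∀ m ∈ insert n τ, m ≤ n := fun m hm => by
    rcases Finset.mem_insert.1 hm with rfl | hm
    exacts [le_rfl, (hτ m hm).le]
  rcases hdec (insert n τ) n (Finset.mem_insert_self n τ) hn.1 hle with h | h
  · exact absurd ⟨hn.1, h⟩ hn.2
  · exact h.mono fun k hk _ => hk.1

theorem exists_forall_union_rejects {U : Set IOI} {σ : Finset ℕ} {X : Set ℕ} (hX : X.Infinite)
    (hrej : Rejects U X σ) :
    ∃ Y ⊆ X, Y.Infinite ∧
      ∀ ρ : Finset ℕ, (∀ n ∈ ρ, n ∈ Y ∧ ∀ m ∈ σ, m < n) → Rejects U Y (σ ∪ ρ) := by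
  let Q : Finset ℕ → Set ℕ → Prop := fun τ X =>
    ES τ X ⊆ U ∨ ∀ n ∈ X, (∀ m ∈ τ, m < n) → Rejects U X (insert n τ)
  have hmono : ∀ τ X Y, AboveSubset τ Y X → Q τ X → Q τ Y := fun τ X Y hYX h =>
    h.imp (ES_subset_of_aboveSubset hYX).trans fun h n hn hτ =>
      (h n (hYX n hn hτ) hτ).mono fun k hk hlt =>
        hYX k hk fun m hm => hlt m (Finset.mem_insert_of_mem hm)
  have hdense : ∀ τ (X : Set ℕ), X.Infinite → ∃ Y ⊆ X, Y.Infinite ∧ Q τ Y := fun τ _ =>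
    exists_subset_or_rejects_insert U τ
  obtain ⟨S, hSX, hS, hσ⟩ := hdense σ X hX
  obtain ⟨Y, hYS, hY, hQ⟩ := exists_fusion_s4 hmono hdense hS
  refine ⟨Y, hYS.trans hSX, hY, fun ρ => ?_⟩
  induction ρ using Finset.induction_on_max with
  | empty =>
    intro _
    rw [Finset.union_empty]
    exact hrej.mono fun n hn _ => hSX (hYS hn)
  | insert k ρ hk ih =>
    intro hρ
    have hρ' : ∀ n ∈ ρ, n ∈ Y ∧ ∀ m ∈ σ, m < n := fun n hn => hρ n (Finset.mem_insert_of_mem hn)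
    have hkY := hρ k (Finset.mem_insert_self k ρ)
    have hQρ : Q (σ ∪ ρ) Y := by
      rcases ρ.eq_empty_or_nonempty with rfl | hne
      · rw [Finset.union_empty]
        exact hmono σ S Y (fun n hn _ => hYS hn) hσ
      · have hmax := ρ.max'_mem hne
        refine hQ _ (ρ.max' hne) (Finset.mem_union_right _ hmax) (hρ' _ hmax).1 fun m hm => ?_
        rcases Finset.mem_union.1 hm with hm | hm
        exacts [((hρ' _ hmax).2 m hm).le, ρ.le_max' m hm]
    rw [Finset.union_insert]
    rcases hQρ with h | h
    · exact absurd h (ih hρ' Y hY fun n hn _ => hn)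
    · refine h k hkY.1 fun m hm => ?_
      rcases Finset.mem_union.1 hm with hm | hm
      exacts [hkY.2 m hm, hk m hm]

theorem exists_forall_eq_imp_mem {U : Set IOI} (hU : IsOpen U) {a : IOI} (ha : a ∈ U) :
    ∃ N : ℕ, ∀ b : IOI, (∀ n < N, b.1 n = a.1 n) → b ∈ U := by
  obtain ⟨V, hV, rfl⟩ := isOpen_induced_iff.1 hU
  obtain ⟨I, u, hu, hsub⟩ := isOpen_pi_iff.1 hV a.1 ha
  refine ⟨I.sup id + 1, fun b hb => hsub fun n hn => ?_⟩
  have : n ≤ I.sup id := Finset.le_sup (f := id) hn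
  rw [hb n (by omega)]
  exact (hu n hn).2

/-- Open sets are completely Ramsey. -/
theorem exists_ES_subset_or_disjoint {U : Set IOI} (hU : IsOpen U) (σ : Finset ℕ) {s : Set ℕ}
    (hs : s.Infinite) :
    ∃ s' ⊆ s, s'.Infinite ∧ (ES σ s' ⊆ U ∨ Disjoint (ES σ s') U) := by
  obtain ⟨X, hXs, hX, hacc | hrej⟩ := exists_subset_or_rejects U σ hs
  · exact ⟨X, hXs, hX, Or.inl hacc⟩
  obtain ⟨Y, hYX, hY, hYrej⟩ := exists_forall_union_rejects hX hrej
  refine ⟨Y, hYX.trans hXs, hY, Or.inr (Set.disjoint_left.2 fun a ha haU => ?_)⟩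
  obtain ⟨N, hN⟩ := exists_forall_eq_imp_mem hU haU
  obtain ⟨M, hM, hNM⟩ := a.2.exists_gt N
  let ρ := (Finset.range (M + 1)).filter fun n => a.1 n = true ∧ n ∉ σ
  have hmem : ∀ n, n ∈ σ ∪ ρ ↔ n ∈ σ ∨ n ≤ M ∧ a.1 n = true := fun n => by
    simp only [ρ, Finset.mem_union, Finset.mem_filter, Finset.mem_range]
    grind
  refine hYrej ρ (fun n hn => ?_) Y hY (fun n hn _ => hn) fun b hb => hN b fun n hn => ?_
  · obtain ⟨han, hnσ⟩ := (Finset.mem_filter.1 hn).2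
    exact ha.2 n han hnσ
  · rw [Bool.eq_iff_iff]
    constructor
    · intro hbn
      by_cases h : n ∈ σ ∪ ρ
      · exact ((hmem n).1 h).elim (ha.1 n) And.right
      · have := (hb.2 n hbn h).2 M ((hmem M).2 (Or.inr ⟨le_rfl, hM⟩))
        omega
    · exact fun han => hb.1 n ((hmem n).2 (Or.inr ⟨by omega, han⟩))

/-- A closed `C ⊆ [ω]^ω` is Ramsey positive iff it contains some Ellentuck basic
set `[σ,s]`. -/
theorem statement4 (C : Set IOI) (hC : IsClosed C) :
    RamseyPositive C ↔ ∃ (σ : Finset ℕ) (s : Set ℕ), GoodPair σ s ∧ ES σ s ⊆ C := by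
  constructor
  · intro hpos
    by_contra! hno
    refine hpos fun σ s hσs => ?_
    obtain ⟨s', hs', hinf, h | h⟩ := exists_ES_subset_or_disjoint hC.isOpen_compl σ hσs.1
    · exact ⟨s', hs', hinf, fun m hm n hn => hσs.2 m hm n (hs' hn),
        (Set.subset_compl_iff_disjoint_right.1 h).inter_eq⟩
    · exact absurd (Set.disjoint_compl_right_iff_subset.1 h)
        (hno σ s' ⟨hinf, fun m hm n hn => hσs.2 m hm n (hs' hn)⟩)
  · rintro ⟨σ, s, hσs, hsub⟩ hnull
    obtain ⟨s', hs', hinf, -, hempty⟩ := hnull σ s hσs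
    obtain ⟨a, ha⟩ := ES_nonempty σ hinf
    exact Set.notMem_empty a
      (hempty ▸ ⟨ha, hsub (ES_subset_of_aboveSubset (fun n hn _ => hs' hn) ha)⟩)
end
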